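/- First Seiberg bound: Let γ ∈ (0, √(2d)), let f : D → ℝ be measurable with 0 < c ≤ f(x) ≤ C for all x ∈ D and some constants c, C, let M be the Gaussian multiplicative chaos measure on D, let x ∈ D be such that the closed ball of center x and radius 1 is contained in D, and let α ∈ ℝ. Then ∫_{B(x,1)} |y − x|^{−αγ} M(dy) < ∞ almost surely if and only if α < d/γ + γ/2. -/

import Mathlib

open MeasureTheory ProbabilityTheory Filter Topology
open scoped ENNReal NNReal

noncomputable section

variable {d : ℕ}

/-- The rescaled mollifier `θ_ε(x) = ε^{-d} θ(x/ε)`. -/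
def mollifierScaled (θ : EuclideanSpace ℝ (Fin d) → ℝ) (ε : ℝ)
    (x : EuclideanSpace ℝ (Fin d)) : ℝ :=
  (ε ^ d)⁻¹ * θ (ε⁻¹ • x)

/-- A nonnegative smooth mollifier: `C^∞`, compactly supported, nonnegative, total integral 1. -/
def IsMollifier (θ : EuclideanSpace ℝ (Fin d) → ℝ) : Prop :=
  ContDiff ℝ (⊤ : ℕ∞) θ ∧ HasCompactSupport θ ∧ (∀ x, 0 ≤ θ x) ∧ (∫ x, θ x) = 1

/-- The kernel of log-type associated to `g`: `K(x,y) = ln₊(1/|x-y|) + g(x,y)` where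
`ln₊ u = max (ln u) 0`. -/
def logKernel (g : EuclideanSpace ℝ (Fin d) → EuclideanSpace ℝ (Fin d) → ℝ)
    (x y : EuclideanSpace ℝ (Fin d)) : ℝ :=
  max (Real.log (dist x y)⁻¹) 0 + g x y

/-- `g` is bounded and (jointly) measurable. -/
def IsBoundedMeasurable (g : EuclideanSpace ℝ (Fin d) → EuclideanSpace ℝ (Fin d) → ℝ) : Prop :=
  Measurable (Function.uncurry g) ∧ ∃ C, ∀ x y, |g x y| ≤ C

/-- The mollified covariance `K_{ε,ε'}(x,y) = ∫∫ θ₁_ε(u) θ₂_{ε'}(v) K(x-u, y-v) du dv`. -/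
def mollifiedCov (K : EuclideanSpace ℝ (Fin d) → EuclideanSpace ℝ (Fin d) → ℝ)
    (θ₁ θ₂ : EuclideanSpace ℝ (Fin d) → ℝ) (ε ε' : ℝ)
    (x y : EuclideanSpace ℝ (Fin d)) : ℝ :=
  ∫ u, ∫ v, mollifierScaled θ₁ ε u * mollifierScaled θ₂ ε' v * K (x - u) (y - v)

/-- `X = (X(ε,x))` is a jointly measurable family whose finite-dimensional distributions are
centered Gaussian with covariance `E[X(ε,x) X(ε',y)] = Km ε ε' x y` (expressed by requiring
every finite real linear combination to have the appropriate centered Gaussian law). -/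
def IsGaussianFamily {Ω : Type*} [MeasurableSpace Ω] (P : Measure Ω)
    (X : ℝ → EuclideanSpace ℝ (Fin d) → Ω → ℝ)
    (Km : ℝ → ℝ → EuclideanSpace ℝ (Fin d) → EuclideanSpace ℝ (Fin d) → ℝ) : Prop :=
  (Measurable fun p : ℝ × EuclideanSpace ℝ (Fin d) × Ω => X p.1 p.2.1 p.2.2) ∧
  ∀ (n : ℕ) (ε : Fin n → ℝ) (x : Fin n → EuclideanSpace ℝ (Fin d)),
    (∀ i, ε i ∈ Set.Ioc (0 : ℝ) 1) → ∀ l : Fin n → ℝ, ∃ v : ℝ≥0,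
      (v : ℝ) = ∑ i, ∑ j, l i * l j * Km (ε i) (ε j) (x i) (x j) ∧
      Measure.map (fun ω => ∑ i, l i * X (ε i) (x i) ω) P = gaussianReal 0 v

/-- The approximate Gaussian multiplicative chaos measure
`M_ε(A) = ∫_A exp(γ X(ε,x) - (γ²/2) Km ε ε x x) f(x) dx`. -/
def approxGMC {Ω : Type*} (γ : ℝ) (X : ℝ → EuclideanSpace ℝ (Fin d) → Ω → ℝ)
    (Km : ℝ → ℝ → EuclideanSpace ℝ (Fin d) → EuclideanSpace ℝ (Fin d) → ℝ)
    (f : EuclideanSpace ℝ (Fin d) → ℝ) (ε : ℝ) (ω : Ω)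
    (A : Set (EuclideanSpace ℝ (Fin d))) : ℝ :=
  ∫ x in A, Real.exp (γ * X ε x ω - γ ^ 2 / 2 * Km ε ε x x) * f x

/-- `M` is the Gaussian multiplicative chaos measure on `D`: a random Radon measure on `D`
such that `M_ε(A) → M(A)` in probability as `ε → 0` for every Borel `A` with compact closure
contained in `D`. -/
def IsGMCMeasure {Ω : Type*} [MeasurableSpace Ω] (P : Measure Ω) (γ : ℝ)
    (X : ℝ → EuclideanSpace ℝ (Fin d) → Ω → ℝ)
    (Km : ℝ → ℝ → EuclideanSpace ℝ (Fin d) → EuclideanSpace ℝ (Fin d) → ℝ)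
    (f : EuclideanSpace ℝ (Fin d) → ℝ) (D : Set (EuclideanSpace ℝ (Fin d)))
    (M : Ω → Measure (EuclideanSpace ℝ (Fin d))) : Prop :=
  (∀ A : Set (EuclideanSpace ℝ (Fin d)), MeasurableSet A → Measurable fun ω => M ω A) ∧
  (∀ ω, ∀ A : Set (EuclideanSpace ℝ (Fin d)), IsCompact (closure A) → closure A ⊆ D →
    M ω A ≠ ⊤) ∧
  (∀ A : Set (EuclideanSpace ℝ (Fin d)), MeasurableSet A → IsCompact (closure A) →
    closure A ⊆ D →
    TendstoInMeasure P (fun ε ω => approxGMC γ X Km f ε ω A) (𝓝[Set.Ioc (0 : ℝ) 1] 0)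
      fun ω => (M ω A).toReal)


/-- The singular part `ln₊ (1 / |w|)` of a kernel of log-type. -/
def logSing (w : EuclideanSpace ℝ (Fin d)) : ℝ := Real.posLog ‖w‖⁻¹

/-- The probability measure with density `θ`. -/
def mollifierMeasure (θ : EuclideanSpace ℝ (Fin d) → ℝ) : Measure (EuclideanSpace ℝ (Fin d)) :=
  volume.withDensity fun u => ENNReal.ofReal (θ u)

lemma logSing_nonneg (w : EuclideanSpace ℝ (Fin d)) : 0 ≤ logSing w := Real.posLog_nonneg

lemma measurable_logSing : Measurable (logSing (d := d)) :=
  Real.continuous_posLog.measurable.comp measurable_norm.inv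

lemma integrable_logSing (hd : 1 ≤ d) : Integrable (logSing (d := d)) := by
  have : Nonempty (Fin d) := ⟨⟨0, hd⟩⟩
  have h := (integrable_fun_norm_addHaar (volume : Measure (EuclideanSpace ℝ (Fin d)))
    (f := fun t : ℝ => Real.posLog t⁻¹)).2 ?_
  · exact h
  have hlog : IntegrableOn (fun t : ℝ => |Real.log t|) (Set.Ioc 0 1) :=
    ((intervalIntegrable_iff_integrableOn_Ioc_of_le zero_le_one).1
      intervalIntegral.intervalIntegrable_log').abs
  have hind : IntegrableOn (fun t : ℝ => (Set.Ioc (0 : ℝ) 1).indicator (fun t => |Real.log t|) t)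
      (Set.Ioi 0) :=
    (hlog.integrable_indicator measurableSet_Ioc).integrableOn
  refine hind.mono' ?_ ?_
  · refine Measurable.aestronglyMeasurable ?_
    exact (measurable_id.pow_const _).smul
      (Real.continuous_posLog.measurable.comp measurable_inv)
  · refine (ae_restrict_iff' measurableSet_Ioi).2 (ae_of_all _ fun t (ht : 0 < t) => ?_)
    by_cases h1 : t ≤ 1
    · rw [Set.indicator_of_mem (Set.mem_Ioc.2 ⟨ht, h1⟩), norm_smul]
      have : 1 ≤ |t⁻¹| := by rw [abs_of_pos (inv_pos.2 ht)]; exact (one_le_inv₀ ht).2 h1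
      rw [Real.posLog_eq_log this, Real.log_inv, norm_neg, Real.norm_eq_abs (Real.log t)]
      refine mul_le_of_le_one_left (abs_nonneg _) ?_
      rw [Real.norm_eq_abs, abs_of_nonneg (by positivity)]
      exact pow_le_one₀ ht.le h1
    · have : |t⁻¹| ≤ 1 := by
        rw [abs_of_pos (inv_pos.2 ht)]; exact inv_le_one_of_one_le₀ (not_le.1 h1).le
      rw [(Real.posLog_eq_zero_iff _).2 this]
      simp [h1]

lemma logSing_smul_le {ε : ℝ} (hε : 0 < ε) (w : EuclideanSpace ℝ (Fin d)) :
    logSing (ε • w) ≤ Real.posLog ε⁻¹ + logSing w := by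
  unfold logSing
  rw [norm_smul, mul_inv, Real.norm_of_nonneg hε.le]
  exact Real.posLog_mul

lemma logSing_le_of_le_norm {ρ : ℝ} (hρ : 0 < ρ) {w : EuclideanSpace ℝ (Fin d)} (h : ρ ≤ ‖w‖) :
    logSing w ≤ Real.posLog ρ⁻¹ :=
  Real.posLog_le_posLog (by positivity) (inv_anti₀ hρ h)

lemma le_logSing_of_norm_le {ρ : ℝ} {w : EuclideanSpace ℝ (Fin d)} (hw : w ≠ 0)
    (h : ‖w‖ ≤ ρ) : Real.posLog ρ⁻¹ ≤ logSing w :=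
  Real.posLog_le_posLog (inv_nonneg.2 ((norm_nonneg w).trans h)) (inv_anti₀ (norm_pos_iff.2 hw) h)

lemma posLog_inv_two_pow (m : ℕ) : Real.posLog (((2 : ℝ) ^ m)⁻¹)⁻¹ = m * Real.log 2 := by
  rw [inv_inv, Real.posLog_eq_log, Real.log_pow]
  rw [abs_of_pos (by positivity)]
  exact one_le_pow₀ one_le_two

lemma logKernel_eq (g : EuclideanSpace ℝ (Fin d) → EuclideanSpace ℝ (Fin d) → ℝ)
    (x y : EuclideanSpace ℝ (Fin d)) : logKernel g x y = logSing (x - y) + g x y := by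
  rw [logKernel, logSing, dist_eq_norm, Real.posLog_apply, max_comm]

section Mollifier

variable {θ : EuclideanSpace ℝ (Fin d) → ℝ}

lemma IsMollifier.measurable (hθ : IsMollifier θ) : Measurable θ := hθ.1.continuous.measurable

lemma IsMollifier.isProbabilityMeasure (hθ : IsMollifier θ) :
    IsProbabilityMeasure (mollifierMeasure θ) := by
  constructor
  have hint : Integrable θ := hθ.1.continuous.integrable_of_hasCompactSupport hθ.2.1
  rw [mollifierMeasure, withDensity_apply _ MeasurableSet.univ, Measure.restrict_univ,
    ← ofReal_integral_eq_lintegral_ofReal hint (ae_of_all _ hθ.2.2.1), hθ.2.2.2,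
    ENNReal.ofReal_one]

lemma IsMollifier.exists_measure_le (hθ : IsMollifier θ) :
    ∃ B : ℝ≥0, mollifierMeasure θ ≤ B • (volume : Measure (EuclideanSpace ℝ (Fin d))) := by
  obtain ⟨B, hB⟩ := hθ.1.continuous.bounded_above_of_compact_support hθ.2.1
  refine ⟨B.toNNReal, ?_⟩
  have : (B.toNNReal • volume : Measure (EuclideanSpace ℝ (Fin d)))
      = volume.withDensity fun _ => ENNReal.ofReal B := by
    rw [withDensity_const]; rfl
  rw [this, mollifierMeasure]
  refine withDensity_mono (ae_of_all _ fun u => ENNReal.ofReal_le_ofReal ?_)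
  exact (le_abs_self _).trans (hB u)

lemma IsMollifier.absolutelyContinuous :
    mollifierMeasure θ ≪ (volume : Measure (EuclideanSpace ℝ (Fin d))) :=
  withDensity_absolutelyContinuous _ _

lemma IsMollifier.exists_ae_norm_le (hθ : IsMollifier θ) :
    ∃ R : ℝ, 1 ≤ R ∧ ∀ᵐ u ∂(mollifierMeasure θ), ‖u‖ ≤ R := by
  obtain ⟨R, hR⟩ := hθ.2.1.isCompact.isBounded.exists_norm_le
  refine ⟨max R 1, le_max_right _ _, ?_⟩
  rw [mollifierMeasure, ae_withDensity_iff hθ.measurable.ennreal_ofReal]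
  refine ae_of_all _ fun u hu => (hR u ?_).trans (le_max_left _ _)
  refine subset_tsupport _ fun h => hu ?_
  simp [h]

lemma IsMollifier.integral_mollifierScaled_mul (hθ : IsMollifier θ) {ε : ℝ} (hε : 0 < ε)
    (F : EuclideanSpace ℝ (Fin d) → ℝ) :
    ∫ u, mollifierScaled θ ε u * F u = ∫ u, F (ε • u) ∂(mollifierMeasure θ) := by
  have h := Measure.integral_comp_smul_of_nonneg
    (volume : Measure (EuclideanSpace ℝ (Fin d))) (fun u => θ (ε⁻¹ • u) * F u) ε (hR := hε.le)
  rw [mollifierMeasure, integral_withDensity_eq_integral_toReal_smul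
    hθ.measurable.ennreal_ofReal (ae_of_all _ fun _ => ENNReal.ofReal_lt_top)]
  simp only [smul_smul, inv_mul_cancel₀ hε.ne', one_smul, finrank_euclideanSpace,
    Fintype.card_fin] at h
  simp only [ENNReal.toReal_ofReal (hθ.2.2.1 _), smul_eq_mul, mollifierScaled, mul_assoc,
    integral_const_mul]
  rw [h, smul_eq_mul]

lemma IsMollifier.mollifiedCov_eq (hθ : IsMollifier θ)
    (K : EuclideanSpace ℝ (Fin d) → EuclideanSpace ℝ (Fin d) → ℝ) {ε ε' : ℝ} (hε : 0 < ε)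
    (hε' : 0 < ε') (x y : EuclideanSpace ℝ (Fin d)) :
    mollifiedCov K θ θ ε ε' x y =
      ∫ u, ∫ v, K (x - ε • u) (y - ε' • v) ∂(mollifierMeasure θ) ∂(mollifierMeasure θ) := by
  simp only [mollifiedCov, mul_assoc, integral_const_mul]
  rw [hθ.integral_mollifierScaled_mul hε
    (fun u => ∫ v, mollifierScaled θ ε' v * K (x - u) (y - v))]
  congr 1 with u
  exact hθ.integral_mollifierScaled_mul hε' _

lemma IsMollifier.integrable_logSing (hd : 1 ≤ d) (hθ : IsMollifier θ) {ε : ℝ} (hε : 0 < ε)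
    (a : EuclideanSpace ℝ (Fin d)) :
    Integrable (fun v => logSing (a + ε • v)) (mollifierMeasure θ) := by
  have := hθ.isProbabilityMeasure
  obtain ⟨B, hB⟩ := hθ.exists_measure_le
  have h : Integrable (fun v => logSing (ε⁻¹ • a + v)) (mollifierMeasure θ) :=
    (((_root_.integrable_logSing hd).comp_add_left (ε⁻¹ • a)).smul_measure_nnreal).mono_measure hB
  refine ((integrable_const (Real.posLog ε⁻¹)).add h).mono'
    (measurable_logSing.comp (by fun_prop)).aestronglyMeasurable (ae_of_all _ fun v => ?_)
  rw [Real.norm_of_nonneg (logSing_nonneg _)]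
  have := logSing_smul_le hε (ε⁻¹ • a + v)
  rwa [smul_add, smul_smul, mul_inv_cancel₀ hε.ne', one_smul] at this

lemma IsMollifier.exists_integral_logSing_le_posLog (hd : 1 ≤ d) (hθ : IsMollifier θ) :
    ∃ κ : ℝ, 0 ≤ κ ∧ ∀ ε : ℝ, 0 < ε → ∀ a : EuclideanSpace ℝ (Fin d),
      ∫ v, logSing (a + ε • v) ∂(mollifierMeasure θ) ≤ Real.posLog ε⁻¹ + κ := by
  have := hθ.isProbabilityMeasure
  obtain ⟨B, hB⟩ := hθ.exists_measure_le
  refine ⟨B * ∫ w, logSing (d := d) w,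
    mul_nonneg B.2 (integral_nonneg logSing_nonneg), fun ε hε a => ?_⟩
  have hi : Integrable (fun v => logSing (ε⁻¹ • a + v)) (B • volume) :=
    ((_root_.integrable_logSing hd).comp_add_left (ε⁻¹ • a)).smul_measure_nnreal
  calc ∫ v, logSing (a + ε • v) ∂(mollifierMeasure θ)
      ≤ ∫ v, (Real.posLog ε⁻¹ + logSing (ε⁻¹ • a + v)) ∂(mollifierMeasure θ) := by
        refine integral_mono (hθ.integrable_logSing hd hε a)
          ((integrable_const _).add (hi.mono_measure hB)) fun v => ?_
        have := logSing_smul_le hε (ε⁻¹ • a + v)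
        rwa [smul_add, smul_smul, mul_inv_cancel₀ hε.ne', one_smul] at this
    _ = Real.posLog ε⁻¹ + ∫ v, logSing (ε⁻¹ • a + v) ∂(mollifierMeasure θ) := by
        rw [integral_add (integrable_const _) (hi.mono_measure hB)]; simp
    _ ≤ Real.posLog ε⁻¹ + ∫ v, logSing (ε⁻¹ • a + v) ∂(B • volume) := by
        gcongr
        exact ae_of_all _ fun v => logSing_nonneg _
    _ = Real.posLog ε⁻¹ + B * ∫ w, logSing (d := d) w := by
        rw [integral_smul_nnreal_measure, integral_add_left_eq_self (logSing (d := d))]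
        rfl

lemma IsMollifier.exists_integral_logSing_le (hd : 1 ≤ d) (hθ : IsMollifier θ) :
    ∃ κ : ℝ, 0 ≤ κ ∧ ∀ ε : ℝ, 0 < ε → ∀ a : EuclideanSpace ℝ (Fin d), a ≠ 0 →
      ∫ v, logSing (a + ε • v) ∂(mollifierMeasure θ) ≤ logSing a + κ := by
  have := hθ.isProbabilityMeasure
  obtain ⟨κ, hκ, hκ'⟩ := hθ.exists_integral_logSing_le_posLog hd
  obtain ⟨R, hR1, hR⟩ := hθ.exists_ae_norm_le
  refine ⟨κ + Real.posLog (2 * R), add_nonneg hκ Real.posLog_nonneg, fun ε hε a ha => ?_⟩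
  have ha' : 0 < ‖a‖ := norm_pos_iff.2 ha
  by_cases h : ‖a‖ ≤ 2 * R * ε
  · have h1 : Real.posLog ε⁻¹ ≤ logSing a + Real.posLog (2 * R) := by
      refine (Real.posLog_le_posLog (by positivity) ?_).trans Real.posLog_mul
      rw [inv_mul_eq_div, inv_le_comm₀ hε (by positivity), inv_div, div_le_iff₀ (by positivity)]
      linarith
    linarith [hκ' ε hε a]
  · have h1 : ∀ᵐ v ∂(mollifierMeasure θ), logSing (a + ε • v) ≤ logSing a + Real.posLog (2 * R) := by
      filter_upwards [hR] with v hv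
      have h2 : ‖a‖ / (2 * R) ≤ ‖a + ε • v‖ := by
        have h3 : ‖ε • v‖ ≤ ε * R := by
          rw [norm_smul, Real.norm_of_nonneg hε.le]; gcongr
        have h4 : ‖a‖ ≤ ‖a + ε • v‖ + ‖ε • v‖ := by
          simpa using norm_sub_le (a + ε • v) (ε • v)
        have h5 : ‖a‖ / (2 * R) ≤ ‖a‖ / 2 := by gcongr; linarith
        linarith
      refine (logSing_le_of_le_norm (by positivity) h2).trans ?_
      rw [inv_div, div_eq_mul_inv, mul_comm]
      exact Real.posLog_mul
    calc _ ≤ ∫ v, (logSing a + Real.posLog (2 * R)) ∂(mollifierMeasure θ) :=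
          integral_mono_ae (hθ.integrable_logSing hd hε a) (integrable_const _) h1
      _ ≤ _ := by simp; linarith

end Mollifier

/-- The covariance of the mollified fields is comparable to the logarithm of the larger of the
distance and the two mollification scales, when that quantity is close to `2 ^ (-m)`. -/
def IsLogCovariance
    (Km : ℝ → ℝ → EuclideanSpace ℝ (Fin d) → EuclideanSpace ℝ (Fin d) → ℝ) (κ : ℝ) : Prop :=
  ∀ (m : ℕ) (ε ε' : ℝ), 0 < ε → 0 < ε' → ∀ y z : EuclideanSpace ℝ (Fin d),
    ((2 : ℝ) ^ m)⁻¹ ≤ max (dist y z) (max ε ε') → max (dist y z) (max ε ε') ≤ 2 * ((2 : ℝ) ^ m)⁻¹ →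
      |Km ε ε' y z - m * Real.log 2| ≤ κ

section Covariance

variable {θ : EuclideanSpace ℝ (Fin d) → ℝ}
  {g : EuclideanSpace ℝ (Fin d) → EuclideanSpace ℝ (Fin d) → ℝ}

lemma measurable_logKernel (hg : IsBoundedMeasurable g) :
    Measurable fun p : EuclideanSpace ℝ (Fin d) × EuclideanSpace ℝ (Fin d) =>
      logKernel g p.1 p.2 := by
  simp only [logKernel_eq]
  exact (measurable_logSing.comp (measurable_fst.sub measurable_snd)).add hg.1

lemma IsMollifier.exists_isLogCovariance (hd : 1 ≤ d) (hg : IsBoundedMeasurable g)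
    (hθ : IsMollifier θ) :
    ∃ κ : ℝ, 0 ≤ κ ∧ IsLogCovariance (mollifiedCov (logKernel g) θ θ) κ := by
  have : Nonempty (Fin d) := ⟨⟨0, hd⟩⟩
  have := hθ.isProbabilityMeasure
  obtain ⟨κ₁, hκ₁, h₁⟩ := hθ.exists_integral_logSing_le_posLog hd
  obtain ⟨κ₂, hκ₂, h₂⟩ := hθ.exists_integral_logSing_le hd
  obtain ⟨R, hR1, hR⟩ := hθ.exists_ae_norm_le
  obtain ⟨Cg, hCg⟩ := hg.2
  have hCg0 : 0 ≤ Cg := (abs_nonneg _).trans (hCg 0 0)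
  set μ := mollifierMeasure θ with hμ
  have hatom : ∀ (a : EuclideanSpace ℝ (Fin d)) (ε : ℝ), 0 < ε → ∀ᵐ u ∂μ, a + ε • u ≠ 0 := by
    intro a ε hε
    have : ∀ᵐ u ∂(volume : Measure (EuclideanSpace ℝ (Fin d))), u ≠ -(ε⁻¹ • a) := by
      simp [ae_iff]
    filter_upwards [IsMollifier.absolutelyContinuous.ae_le this] with u hu h
    refine hu ?_
    rw [eq_neg_of_add_eq_zero_left h, smul_neg, neg_neg, smul_smul, inv_mul_cancel₀ hε.ne',
      one_smul]
  have hlogR : 0 ≤ Real.posLog (2 * (1 + 2 * R)) := Real.posLog_nonneg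
  refine ⟨κ₁ + 2 * κ₂ + Cg + Real.posLog (2 * (1 + 2 * R)), by positivity, ?_⟩
  intro m ε ε' hε hε' y z hlo hhi
  rw [hθ.mollifiedCov_eq _ hε hε', ← hμ]
  set ρ : ℝ := ((2 : ℝ) ^ m)⁻¹ with hρ
  have hρ0 : 0 < ρ := by positivity
  have hρm : Real.posLog ρ⁻¹ = m * Real.log 2 := posLog_inv_two_pow m
  have hKeq : ∀ u v, logKernel g (y - ε • u) (z - ε' • v) =
      logSing ((y - z + ε • (-u)) + ε' • v) + g (y - ε • u) (z - ε' • v) := by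
    intro u v
    rw [logKernel_eq]
    congr 2
    rw [smul_neg]; abel
  have hgi : ∀ u, Integrable (fun v => g (y - ε • u) (z - ε' • v)) μ := fun u =>
    (integrable_const Cg).mono'
      (hg.1.comp (by fun_prop : Measurable fun v => (y - ε • u, z - ε' • v))).aestronglyMeasurable
      (ae_of_all _ fun v => hCg _ _)
  have hLi : ∀ u, Integrable (fun v => logSing ((y - z + ε • (-u)) + ε' • v)) μ := fun u =>
    hθ.integrable_logSing hd hε' _
  set F : EuclideanSpace ℝ (Fin d) → ℝ := fun u =>
    ∫ v, logKernel g (y - ε • u) (z - ε' • v) ∂μ with hF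
  have hFeq : ∀ u, F u = ∫ v, logSing ((y - z + ε • (-u)) + ε' • v) ∂μ +
      ∫ v, g (y - ε • u) (z - ε' • v) ∂μ := fun u => by
    simp only [hF, hKeq]
    exact integral_add (hLi u) (hgi u)
  have hgb : ∀ u, |∫ v, g (y - ε • u) (z - ε' • v) ∂μ| ≤ Cg := fun u => by
    have := norm_integral_le_of_norm_le_const (μ := μ)
      (f := fun v => g (y - ε • u) (z - ε' • v)) (ae_of_all _ fun v => hCg _ _)
    simpa using this
  have hFm : StronglyMeasurable F := by
    refine StronglyMeasurable.integral_prod_right' (f := fun p :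
      EuclideanSpace ℝ (Fin d) × EuclideanSpace ℝ (Fin d) =>
        logKernel g (y - ε • p.1) (z - ε' • p.2)) ?_
    exact ((measurable_logKernel hg).comp
      (by fun_prop : Measurable fun p : EuclideanSpace ℝ (Fin d) × EuclideanSpace ℝ (Fin d) =>
        (y - ε • p.1, z - ε' • p.2))).stronglyMeasurable
  have hFi : Integrable F μ := by
    refine (integrable_const (Real.posLog ε'⁻¹ + κ₁ + Cg)).mono' hFm.aestronglyMeasurable
      (ae_of_all _ fun u => ?_)
    have h3 := h₁ ε' hε' (y - z + ε • (-u))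
    have h4 : 0 ≤ ∫ v, logSing ((y - z + ε • (-u)) + ε' • v) ∂μ :=
      integral_nonneg fun v => logSing_nonneg _
    have h5 := abs_le.1 (hgb u)
    have h6 : 0 ≤ Real.posLog ε'⁻¹ := Real.posLog_nonneg
    rw [Real.norm_eq_abs, hFeq u, abs_le]
    constructor <;> linarith [h5.1, h5.2]
  rw [abs_le]
  constructor
  · have hlow : ∀ᵐ u ∂μ, m * Real.log 2 - Real.posLog (2 * (1 + 2 * R)) - Cg ≤ F u := by
      filter_upwards [hR] with u hu
      have hin : m * Real.log 2 - Real.posLog (2 * (1 + 2 * R)) ≤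
          ∫ v, logSing ((y - z + ε • (-u)) + ε' • v) ∂μ := by
        have hae : ∀ᵐ v ∂μ, m * Real.log 2 - Real.posLog (2 * (1 + 2 * R)) ≤
            logSing ((y - z + ε • (-u)) + ε' • v) := by
          filter_upwards [hR, hatom (y - z + ε • (-u)) ε' hε'] with v hv hne
          have hn : ‖(y - z + ε • (-u)) + ε' • v‖ ≤ (2 * (1 + 2 * R)) * ρ := by
            have e1 : ‖ε • (-u)‖ ≤ (2 * ρ) * R := by
              rw [norm_smul, norm_neg, Real.norm_of_nonneg hε.le]
              gcongr
              exact (le_max_left _ _).trans ((le_max_right _ _).trans hhi)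
            have e2 : ‖ε' • v‖ ≤ (2 * ρ) * R := by
              rw [norm_smul, Real.norm_of_nonneg hε'.le]
              gcongr
              exact (le_max_right _ _).trans ((le_max_right _ _).trans hhi)
            have e3 : ‖y - z‖ ≤ 2 * ρ := by
              rw [← dist_eq_norm]; exact (le_max_left _ _).trans hhi
            calc _ ≤ ‖y - z‖ + ‖ε • (-u)‖ + ‖ε' • v‖ := norm_add₃_le
              _ ≤ 2 * ρ + (2 * ρ) * R + (2 * ρ) * R := by gcongr
              _ = _ := by ring
          have h3 := le_logSing_of_norm_le hne hn
          have h4 : Real.posLog ρ⁻¹ ≤ Real.posLog (2 * (1 + 2 * R)) +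
              Real.posLog ((2 * (1 + 2 * R)) * ρ)⁻¹ := by
            have h5 : ρ⁻¹ = (2 * (1 + 2 * R)) * ((2 * (1 + 2 * R)) * ρ)⁻¹ := by
              field_simp
            conv_lhs => rw [h5]
            exact Real.posLog_mul
          linarith
        have := integral_mono_ae (integrable_const _) (hLi u) hae
        simpa using this
      have h5 := abs_le.1 (hgb u)
      rw [hFeq u]
      linarith [h5.1]
    have := integral_mono_ae (integrable_const _) hFi hlow
    simp only [integral_const, probReal_univ, one_smul] at this
    linarith
  · suffices h : ∫ u, F u ∂μ ≤ m * Real.log 2 + κ₁ + 2 * κ₂ + Cg by linarith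
    by_cases hc : ρ ≤ ε'
    · have hup : ∀ u, F u ≤ m * Real.log 2 + κ₁ + Cg := fun u => by
        have h3 := h₁ ε' hε' (y - z + ε • (-u))
        have h6 : Real.posLog ε'⁻¹ ≤ Real.posLog ρ⁻¹ :=
          Real.posLog_le_posLog (by positivity) (inv_anti₀ hρ0 hc)
        have h5 := abs_le.1 (hgb u)
        rw [hFeq u]
        linarith [h5.2]
      have := integral_mono hFi (integrable_const _) hup
      simp only [integral_const, probReal_univ, one_smul] at this
      linarith
    · have hneg : ∀ u, y - z + ε • (-u) = -((z - y) + ε • u) := fun u => by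
        rw [smul_neg]; abel
      have hLn : ∀ u, logSing (y - z + ε • (-u)) = logSing ((z - y) + ε • u) := fun u => by
        rw [hneg, logSing, norm_neg, logSing]
      have hup : ∀ᵐ u ∂μ, F u ≤ logSing ((z - y) + ε • u) + (κ₂ + Cg) := by
        filter_upwards [hatom (z - y) ε hε] with u hu
        have h3 := h₂ ε' hε' (y - z + ε • (-u)) (by rw [hneg]; exact neg_ne_zero.2 hu)
        have h5 := abs_le.1 (hgb u)
        rw [hLn] at h3
        rw [hFeq u]
        linarith [h5.2]
      have hLi2 := hθ.integrable_logSing hd hε (z - y)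
      have h7 := integral_mono_ae hFi (hLi2.add (integrable_const _)) hup
      simp only [Pi.add_apply] at h7
      rw [integral_add hLi2 (integrable_const _)] at h7
      simp only [integral_const, probReal_univ, one_smul] at h7
      have h8 : ∫ u, logSing ((z - y) + ε • u) ∂μ ≤ m * Real.log 2 + (κ₁ + κ₂) := by
        by_cases hc2 : ρ ≤ ε
        · have h6 : Real.posLog ε⁻¹ ≤ Real.posLog ρ⁻¹ :=
            Real.posLog_le_posLog (by positivity) (inv_anti₀ hρ0 hc2)
          linarith [h₁ ε hε (z - y)]
        · have h9 : ρ ≤ ‖z - y‖ := by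
            rw [← dist_eq_norm, dist_comm]
            rcases le_max_iff.1 hlo with h | h
            · exact h
            · rcases le_max_iff.1 h with h | h
              · exact absurd h hc2
              · exact absurd h hc
          have h10 := h₂ ε hε (z - y) (norm_pos_iff.1 (hρ0.trans_le h9))
          linarith [logSing_le_of_le_norm hρ0 h9]
      linarith

lemma measurable_mollifiedCov_diag (hg : IsBoundedMeasurable g) (hθ : IsMollifier θ) {ε : ℝ}
    (hε : 0 < ε) : Measurable fun y => mollifiedCov (logKernel g) θ θ ε ε y y := by
  have := hθ.isProbabilityMeasure
  simp only [hθ.mollifiedCov_eq _ hε hε]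
  refine StronglyMeasurable.measurable ?_
  refine StronglyMeasurable.integral_prod_right' (f := fun p :
      EuclideanSpace ℝ (Fin d) × EuclideanSpace ℝ (Fin d) =>
      ∫ v, logKernel g (p.1 - ε • p.2) (p.1 - ε • v) ∂(mollifierMeasure θ)) ?_
  refine StronglyMeasurable.integral_prod_right' (f := fun q :
      (EuclideanSpace ℝ (Fin d) × EuclideanSpace ℝ (Fin d)) × EuclideanSpace ℝ (Fin d) =>
      logKernel g (q.1.1 - ε • q.1.2) (q.1.1 - ε • q.2)) ?_
  exact ((measurable_logKernel hg).comp
      (by fun_prop : Measurable fun q : (EuclideanSpace ℝ (Fin d) × EuclideanSpace ℝ (Fin d)) ×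
        EuclideanSpace ℝ (Fin d) =>
        (q.1.1 - ε • q.1.2, q.1.1 - ε • q.2))).stronglyMeasurable

end Covariance

section ExponentialMoments

variable {Ω : Type*} [MeasurableSpace Ω] {P : Measure Ω}
  {X : ℝ → EuclideanSpace ℝ (Fin d) → Ω → ℝ}
  {Km : ℝ → ℝ → EuclideanSpace ℝ (Fin d) → EuclideanSpace ℝ (Fin d) → ℝ}

lemma IsGaussianFamily.measurable_apply (hX : IsGaussianFamily P X Km) (ε : ℝ)
    (y : EuclideanSpace ℝ (Fin d)) : Measurable (X ε y) :=
  hX.1.comp (measurable_const.prodMk (measurable_const.prodMk measurable_id))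

lemma IsGaussianFamily.measurable_uncurry (hX : IsGaussianFamily P X Km) (ε : ℝ) :
    Measurable fun p : EuclideanSpace ℝ (Fin d) × Ω => X ε p.1 p.2 :=
  hX.1.comp (measurable_const.prodMk measurable_id)

variable [IsProbabilityMeasure P]

lemma IsGaussianFamily.lintegral_exp (hX : IsGaussianFamily P X Km) {n : ℕ} {ε : Fin n → ℝ}
    (hε : ∀ i, ε i ∈ Set.Ioc (0 : ℝ) 1) (y : Fin n → EuclideanSpace ℝ (Fin d)) (l : Fin n → ℝ) :
    ∫⁻ ω, ENNReal.ofReal (Real.exp (∑ i, l i * X (ε i) (y i) ω)) ∂P =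
      ENNReal.ofReal (Real.exp ((∑ i, ∑ j, l i * l j * Km (ε i) (ε j) (y i) (y j)) / 2)) := by
  obtain ⟨v, hv, hmap⟩ := hX.2 n ε y hε l
  have hmgf := mgf_gaussianReal hmap 1
  have hint : Integrable (fun ω => Real.exp (∑ i, l i * X (ε i) (y i) ω)) P := by
    have h1 : 0 < mgf (fun ω => ∑ i, l i * X (ε i) (y i) ω) P 1 := by
      rw [hmgf]; exact Real.exp_pos _
    simpa using mgf_pos_iff.1 h1
  rw [← ofReal_integral_eq_lintegral_ofReal hint (ae_of_all _ fun _ => (Real.exp_pos _).le), ← hv]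
  congr 1
  simpa [mgf] using hmgf

/-- The scale at which a pair of mollified fields decorrelates is about `2 ^ (-m)`. -/
def IsPairScale (ε ε' : ℝ) (y z : EuclideanSpace ℝ (Fin d)) (m : ℕ) : Prop :=
  ((2 : ℝ) ^ m)⁻¹ ≤ max (dist y z) (max ε ε') ∧ max (dist y z) (max ε ε') ≤ 2 * ((2 : ℝ) ^ m)⁻¹

lemma IsPairScale.symm {ε ε' : ℝ} {y z : EuclideanSpace ℝ (Fin d)} {m : ℕ}
    (h : IsPairScale ε ε' y z m) : IsPairScale ε' ε z y m := by
  unfold IsPairScale at *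
  rwa [dist_comm, max_comm ε' ε]

lemma isPairScale_of_dist_le {ε : ℝ} {y z : EuclideanSpace ℝ (Fin d)} {m : ℕ}
    (hε : ε ≤ ((2 : ℝ) ^ m)⁻¹) (h : dist y z ≤ 2 * ((2 : ℝ) ^ m)⁻¹) :
    IsPairScale ((2 : ℝ) ^ m)⁻¹ ε y z m := by
  have h0 : (0 : ℝ) < ((2 : ℝ) ^ m)⁻¹ := by positivity
  refine ⟨(le_max_left _ _).trans (le_max_right _ _), max_le h (max_le ?_ ?_)⟩ <;> linarith

lemma IsLogCovariance.abs_sum_sub_le {κ : ℝ} (hκ : IsLogCovariance Km κ) {n : ℕ} {ε : Fin n → ℝ}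
    (hε : ∀ i, 0 < ε i) {y : Fin n → EuclideanSpace ℝ (Fin d)} {m : Fin n → Fin n → ℕ}
    (hm : ∀ i j, IsPairScale (ε i) (ε j) (y i) (y j) (m i j)) (l : Fin n → ℝ) :
    |∑ i, ∑ j, l i * l j * Km (ε i) (ε j) (y i) (y j) -
      (∑ i, ∑ j, l i * l j * m i j) * Real.log 2| ≤ κ * (∑ i, |l i|) ^ 2 := by
  have h1 : ∑ i, ∑ j, l i * l j * Km (ε i) (ε j) (y i) (y j) -
      (∑ i, ∑ j, l i * l j * m i j) * Real.log 2 =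
      ∑ i, ∑ j, l i * l j * (Km (ε i) (ε j) (y i) (y j) - m i j * Real.log 2) := by
    simp only [Finset.sum_mul, mul_sub, Finset.sum_sub_distrib, mul_assoc]
  rw [h1, pow_two, Finset.sum_mul_sum, Finset.mul_sum]
  refine (Finset.abs_sum_le_sum_abs _ _).trans (Finset.sum_le_sum fun i _ => ?_)
  rw [Finset.mul_sum]
  refine (Finset.abs_sum_le_sum_abs _ _).trans (Finset.sum_le_sum fun j _ => ?_)
  rw [abs_mul, abs_mul, mul_comm κ]
  gcongr
  exact hκ _ _ _ (hε i) (hε j) _ _ (hm i j).1 (hm i j).2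

/-- Two-sided bound for the exponential moment of a linear combination of the fields at the
centre `x` and scale `2 ^ (-n)`, at `y` and scale `2 ^ (-J)`, and at `y` and the intermediate
scale `2 ^ (-(n + k))`. -/
lemma IsGaussianFamily.lintegral_exp_three {κ : ℝ} (hX : IsGaussianFamily P X Km)
    (hκ : IsLogCovariance Km κ) {n k J : ℕ} (hJ : n + k ≤ J) {x y : EuclideanSpace ℝ (Fin d)}
    (hy : dist x y ≤ ((2 : ℝ) ^ n)⁻¹) (a b c t : ℝ) :
    ∃ q : ℝ, |q| ≤ κ * (|a| + |b| + |c|) ^ 2 ∧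
    ∫⁻ ω, ENNReal.ofReal (Real.exp (a * X ((2 : ℝ) ^ n)⁻¹ x ω + b * X ((2 : ℝ) ^ J)⁻¹ y ω +
        c * X ((2 : ℝ) ^ (n + k))⁻¹ y ω + t)) ∂P =
      ENNReal.ofReal (Real.exp ((a ^ 2 * n + b ^ 2 * J + c ^ 2 * (n + k) + 2 * a * b * n +
        2 * a * c * n + 2 * b * c * (n + k)) * Real.log 2 / 2 + q / 2 + t)) := by
  have hpos : ∀ m : ℕ, (0 : ℝ) < ((2 : ℝ) ^ m)⁻¹ := fun m => by positivity
  have hle : ∀ {m m' : ℕ}, m ≤ m' → ((2 : ℝ) ^ m')⁻¹ ≤ ((2 : ℝ) ^ m)⁻¹ := fun h =>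
    inv_anti₀ (by positivity) (pow_le_pow_right₀ one_le_two h)
  have hself : ∀ (m m' : ℕ), m ≤ m' → ∀ y : EuclideanSpace ℝ (Fin d),
      IsPairScale ((2 : ℝ) ^ m)⁻¹ ((2 : ℝ) ^ m')⁻¹ y y m := fun m m' h y =>
    isPairScale_of_dist_le (hle h) (by simp)
  have hxy : ∀ m, n ≤ m → IsPairScale ((2 : ℝ) ^ n)⁻¹ ((2 : ℝ) ^ m)⁻¹ x y n := fun m h =>
    isPairScale_of_dist_le (hle h) (by linarith [hpos n])
  set ε : Fin 3 → ℝ := ![((2 : ℝ) ^ n)⁻¹, ((2 : ℝ) ^ J)⁻¹, ((2 : ℝ) ^ (n + k))⁻¹] with hε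
  set p : Fin 3 → EuclideanSpace ℝ (Fin d) := ![x, y, y] with hp
  set l : Fin 3 → ℝ := ![a, b, c] with hl
  set m : Fin 3 → Fin 3 → ℕ := ![![n, n, n], ![n, J, n + k], ![n, n + k, n + k]] with hm
  have hε1 : ∀ i, ε i ∈ Set.Ioc (0 : ℝ) 1 := by
    have h1 : ∀ m : ℕ, ((2 : ℝ) ^ m)⁻¹ ∈ Set.Ioc (0 : ℝ) 1 := fun m =>
      ⟨hpos m, inv_le_one_of_one_le₀ (one_le_pow₀ one_le_two)⟩
    intro i; fin_cases i
    exacts [h1 _, h1 _, h1 _]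
  have hscale : ∀ i j, IsPairScale (ε i) (ε j) (p i) (p j) (m i j) := by
    intro i j
    fin_cases i <;> fin_cases j
    exacts [hself n n le_rfl x, hxy J (by omega), hxy (n + k) (by omega),
      (hxy J (by omega)).symm, hself J J le_rfl y, (hself (n + k) J hJ y).symm,
      (hxy (n + k) (by omega)).symm, hself (n + k) J hJ y, hself (n + k) (n + k) le_rfl y]
  have hmain := hX.lintegral_exp hε1 p l
  have hq := hκ.abs_sum_sub_le (fun i => (hε1 i).1) hscale l
  set S := ∑ i, ∑ j, l i * l j * Km (ε i) (ε j) (p i) (p j) with hS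
  refine ⟨S - (∑ i, ∑ j, l i * l j * m i j) * Real.log 2, ?_, ?_⟩
  · refine hq.trans_eq ?_
    simp [Fin.sum_univ_three, hl]
  · simp only [Real.exp_add _ t, ENNReal.ofReal_mul (Real.exp_pos _).le]
    rw [lintegral_mul_const' _ _ ENNReal.ofReal_ne_top]
    congr 1
    have h2 : ∀ ω, ∑ i, l i * X (ε i) (p i) ω = a * X ((2 : ℝ) ^ n)⁻¹ x ω +
        b * X ((2 : ℝ) ^ J)⁻¹ y ω + c * X ((2 : ℝ) ^ (n + k))⁻¹ y ω := fun ω => by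
      simp [Fin.sum_univ_three, hl, hε, hp]
    simp only [h2] at hmain
    rw [hmain]
    congr 2
    have h3 : ∑ i, ∑ j, l i * l j * (m i j : ℝ) = a ^ 2 * n + b ^ 2 * J + c ^ 2 * (n + k) +
        2 * a * b * n + 2 * a * c * n + 2 * b * c * (n + k) := by
      simp [Fin.sum_univ_three, hl, hm]
      ring
    rw [h3]
    ring

/-- Upper bound for the exponential moment of a linear combination of the fields at the
centre `x` and scale `2 ^ (-n)`, at `y` and `z` and scale `2 ^ (-J)`, and at `y` and the scale
`2 ^ (-(n + k))` comparable to the distance between `y` and `z`. -/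
lemma IsGaussianFamily.lintegral_exp_four_le {κ : ℝ} (hX : IsGaussianFamily P X Km)
    (hκ : IsLogCovariance Km κ) {n k J : ℕ} (hJ : n + k ≤ J) {x y z : EuclideanSpace ℝ (Fin d)}
    (hy : dist x y ≤ ((2 : ℝ) ^ n)⁻¹) (hz : dist x z ≤ ((2 : ℝ) ^ n)⁻¹)
    (hyz : IsPairScale ((2 : ℝ) ^ J)⁻¹ ((2 : ℝ) ^ J)⁻¹ y z (n + k)) (a b b' c t : ℝ) :
    ∫⁻ ω, ENNReal.ofReal (Real.exp (a * X ((2 : ℝ) ^ n)⁻¹ x ω + b * X ((2 : ℝ) ^ J)⁻¹ y ω +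
        b' * X ((2 : ℝ) ^ J)⁻¹ z ω + c * X ((2 : ℝ) ^ (n + k))⁻¹ y ω + t)) ∂P ≤
      ENNReal.ofReal (Real.exp ((a ^ 2 * n + b ^ 2 * J + b' ^ 2 * J + c ^ 2 * (n + k) +
        2 * a * b * n + 2 * a * b' * n + 2 * a * c * n + 2 * b * b' * (n + k) +
        2 * b * c * (n + k) + 2 * b' * c * (n + k)) * Real.log 2 / 2 +
        κ * (|a| + |b| + |b'| + |c|) ^ 2 / 2 + t)) := by
  have hpos : ∀ m : ℕ, (0 : ℝ) < ((2 : ℝ) ^ m)⁻¹ := fun m => by positivity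
  have hle : ∀ {m m' : ℕ}, m ≤ m' → ((2 : ℝ) ^ m')⁻¹ ≤ ((2 : ℝ) ^ m)⁻¹ := fun h =>
    inv_anti₀ (by positivity) (pow_le_pow_right₀ one_le_two h)
  have hself : ∀ (m m' : ℕ), m ≤ m' → ∀ y : EuclideanSpace ℝ (Fin d),
      IsPairScale ((2 : ℝ) ^ m)⁻¹ ((2 : ℝ) ^ m')⁻¹ y y m := fun m m' h y =>
    isPairScale_of_dist_le (hle h) (by simp)
  have hxy : ∀ m, n ≤ m → IsPairScale ((2 : ℝ) ^ n)⁻¹ ((2 : ℝ) ^ m)⁻¹ x y n := fun m h =>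
    isPairScale_of_dist_le (hle h) (by linarith [hpos n])
  have hxz : ∀ m, n ≤ m → IsPairScale ((2 : ℝ) ^ n)⁻¹ ((2 : ℝ) ^ m)⁻¹ x z n := fun m h =>
    isPairScale_of_dist_le (hle h) (by linarith [hpos n])
  have hkz : IsPairScale ((2 : ℝ) ^ (n + k))⁻¹ ((2 : ℝ) ^ J)⁻¹ y z (n + k) :=
    isPairScale_of_dist_le (hle hJ) ((le_max_left _ _).trans hyz.2)
  set ε : Fin 4 → ℝ :=
    ![((2 : ℝ) ^ n)⁻¹, ((2 : ℝ) ^ J)⁻¹, ((2 : ℝ) ^ J)⁻¹, ((2 : ℝ) ^ (n + k))⁻¹] with hε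
  set p : Fin 4 → EuclideanSpace ℝ (Fin d) := ![x, y, z, y] with hp
  set l : Fin 4 → ℝ := ![a, b, b', c] with hl
  set m : Fin 4 → Fin 4 → ℕ := ![![n, n, n, n], ![n, J, n + k, n + k], ![n, n + k, J, n + k],
    ![n, n + k, n + k, n + k]] with hm
  have hε1 : ∀ i, ε i ∈ Set.Ioc (0 : ℝ) 1 := by
    have h1 : ∀ m : ℕ, ((2 : ℝ) ^ m)⁻¹ ∈ Set.Ioc (0 : ℝ) 1 := fun m =>
      ⟨hpos m, inv_le_one_of_one_le₀ (one_le_pow₀ one_le_two)⟩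
    intro i; fin_cases i
    exacts [h1 _, h1 _, h1 _, h1 _]
  have hscale : ∀ i j, IsPairScale (ε i) (ε j) (p i) (p j) (m i j) := by
    intro i j
    fin_cases i <;> fin_cases j
    exacts [hself n n le_rfl x, hxy J (by omega), hxz J (by omega), hxy (n + k) (by omega),
      (hxy J (by omega)).symm, hself J J le_rfl y, hyz, (hself (n + k) J hJ y).symm,
      (hxz J (by omega)).symm, hyz.symm, hself J J le_rfl z, hkz.symm,
      (hxy (n + k) (by omega)).symm, hself (n + k) J hJ y, hkz, hself (n + k) (n + k) le_rfl y]
  have hmain := hX.lintegral_exp hε1 p l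
  have hq := (abs_le.1 (hκ.abs_sum_sub_le (fun i => (hε1 i).1) hscale l)).2
  set S := ∑ i, ∑ j, l i * l j * Km (ε i) (ε j) (p i) (p j) with hS
  simp only [Real.exp_add _ t, ENNReal.ofReal_mul (Real.exp_pos _).le]
  rw [lintegral_mul_const' _ _ ENNReal.ofReal_ne_top]
  gcongr
  have h2 : ∀ ω, ∑ i, l i * X (ε i) (p i) ω = a * X ((2 : ℝ) ^ n)⁻¹ x ω +
      b * X ((2 : ℝ) ^ J)⁻¹ y ω + b' * X ((2 : ℝ) ^ J)⁻¹ z ω +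
      c * X ((2 : ℝ) ^ (n + k))⁻¹ y ω := fun ω => by
    simp [Fin.sum_univ_four, hl, hε, hp]
  simp only [h2] at hmain
  rw [hmain]
  gcongr
  have h3 : ∑ i, ∑ j, l i * l j * (m i j : ℝ) = a ^ 2 * n + b ^ 2 * J + b' ^ 2 * J +
      c ^ 2 * (n + k) + 2 * a * b * n + 2 * a * b' * n + 2 * a * c * n + 2 * b * b' * (n + k) +
      2 * b * c * (n + k) + 2 * b' * c * (n + k) := by
    simp [Fin.sum_univ_four, hl, hm]
    ring
  have h4 : ∑ i, |l i| = |a| + |b| + |b'| + |c| := by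
    simp [Fin.sum_univ_four, hl]
  rw [h3, h4] at hq
  linarith

end ExponentialMoments

lemma volume_closedBall_inv_two_pow (x : EuclideanSpace ℝ (Fin d)) (n : ℕ) :
    volume (Metric.closedBall x ((2 : ℝ) ^ n)⁻¹) =
      ENNReal.ofReal (Real.exp (-(d * n * Real.log 2))) *
        volume (Metric.ball (0 : EuclideanSpace ℝ (Fin d)) 1) := by
  rw [Measure.addHaar_closedBall _ _ (by positivity), finrank_euclideanSpace, Fintype.card_fin]
  congr 2
  rw [Real.exp_neg, inv_pow, ← pow_mul]
  congr 1
  rw [← Real.exp_log (show (0 : ℝ) < 2 ^ (n * d) by positivity), Real.log_pow]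
  push_cast
  ring_nf

section Mass

variable {Ω : Type*} [MeasurableSpace Ω] {P : Measure Ω}
  {X : ℝ → EuclideanSpace ℝ (Fin d) → Ω → ℝ}
  {Km : ℝ → ℝ → EuclideanSpace ℝ (Fin d) → EuclideanSpace ℝ (Fin d) → ℝ}
  {γ : ℝ} {f : EuclideanSpace ℝ (Fin d) → ℝ} {D : Set (EuclideanSpace ℝ (Fin d))}

/-- The density of the approximate chaos measure, as an extended nonnegative real. -/
def gmcDensity (γ : ℝ) (X : ℝ → EuclideanSpace ℝ (Fin d) → Ω → ℝ)
    (Km : ℝ → ℝ → EuclideanSpace ℝ (Fin d) → EuclideanSpace ℝ (Fin d) → ℝ)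
    (f : EuclideanSpace ℝ (Fin d) → ℝ) (ε : ℝ) (y : EuclideanSpace ℝ (Fin d)) (ω : Ω) : ℝ≥0∞ :=
  ENNReal.ofReal (Real.exp (γ * X ε y ω - γ ^ 2 / 2 * Km ε ε y y) * f y)

lemma measurable_gmcDensity (hX : IsGaussianFamily P X Km) {ε : ℝ}
    (hdiag : Measurable fun y => Km ε ε y y) (hf : Measurable f) :
    Measurable fun p : EuclideanSpace ℝ (Fin d) × Ω => gmcDensity γ X Km f ε p.1 p.2 := by
  have h1 := hX.measurable_uncurry ε
  have h2 : Measurable fun p : EuclideanSpace ℝ (Fin d) × Ω => Km ε ε p.1 p.1 :=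
    hdiag.comp measurable_fst
  have h3 : Measurable fun p : EuclideanSpace ℝ (Fin d) × Ω => f p.1 := hf.comp measurable_fst
  exact (((h1.const_mul γ).sub (h2.const_mul _)).exp.mul h3).ennreal_ofReal

/-- The mass of `A` under the approximate chaos measure, as an extended nonnegative real. -/
def gmcMass (γ : ℝ) (X : ℝ → EuclideanSpace ℝ (Fin d) → Ω → ℝ)
    (Km : ℝ → ℝ → EuclideanSpace ℝ (Fin d) → EuclideanSpace ℝ (Fin d) → ℝ)
    (f : EuclideanSpace ℝ (Fin d) → ℝ) (ε : ℝ) (A : Set (EuclideanSpace ℝ (Fin d))) (ω : Ω) :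
    ℝ≥0∞ :=
  ∫⁻ y in A, gmcDensity γ X Km f ε y ω

lemma measurable_gmcMass (hX : IsGaussianFamily P X Km) {ε : ℝ}
    (hdiag : Measurable fun y => Km ε ε y y) (hf : Measurable f)
    (A : Set (EuclideanSpace ℝ (Fin d))) : Measurable (gmcMass γ X Km f ε A) :=
  Measurable.lintegral_prod_right' (f := fun p : Ω × EuclideanSpace ℝ (Fin d) =>
    gmcDensity γ X Km f ε p.2 p.1) ((measurable_gmcDensity hX hdiag hf).comp measurable_swap)

/-- Tonelli's theorem for the approximate chaos measure. -/
lemma lintegral_mul_gmcMass [SFinite P] (hX : IsGaussianFamily P X Km) {ε : ℝ}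
    (hdiag : Measurable fun y => Km ε ε y y) (hf : Measurable f)
    (A : Set (EuclideanSpace ℝ (Fin d))) {w : Ω → ℝ≥0∞} (hw : Measurable w) :
    ∫⁻ ω, w ω * gmcMass γ X Km f ε A ω ∂P =
      ∫⁻ y in A, ∫⁻ ω, w ω * gmcDensity γ X Km f ε y ω ∂P := by
  have hm := measurable_gmcDensity (γ := γ) hX hdiag hf
  rw [← lintegral_lintegral_swap (f := fun ω y => w ω * gmcDensity γ X Km f ε y ω)]
  · refine lintegral_congr fun ω => ?_
    rw [lintegral_const_mul]
    · rfl
    · exact hm.comp (measurable_id.prodMk measurable_const)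
  · exact ((hw.comp measurable_fst).mul (hm.comp measurable_swap)).aemeasurable

variable [IsProbabilityMeasure P]

lemma lintegral_gmcDensity (hX : IsGaussianFamily P X Km) {ε : ℝ} (hε : ε ∈ Set.Ioc (0 : ℝ) 1)
    (y : EuclideanSpace ℝ (Fin d)) :
    ∫⁻ ω, gmcDensity γ X Km f ε y ω ∂P = ENNReal.ofReal (f y) := by
  have h := hX.lintegral_exp (ε := fun _ : Fin 1 => ε) (fun _ => hε) (fun _ => y) (fun _ => γ)
  simp only [Finset.univ_unique, Finset.sum_singleton] at h
  simp only [gmcDensity, sub_eq_add_neg, Real.exp_add]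
  simp only [mul_assoc, ENNReal.ofReal_mul (Real.exp_pos _).le]
  rw [lintegral_mul_const' _ _ (by finiteness), h,
    ← mul_assoc, ← ENNReal.ofReal_mul (Real.exp_pos _).le, ← Real.exp_add]
  ring_nf
  simp

lemma ae_ofReal_approxGMC (hX : IsGaussianFamily P X Km) {ε : ℝ} (hε : ε ∈ Set.Ioc (0 : ℝ) 1)
    (hdiag : Measurable fun y => Km ε ε y y) (hf : Measurable f) {C : ℝ}
    {A : Set (EuclideanSpace ℝ (Fin d))} (hA : MeasurableSet A) (hAv : volume A ≠ ⊤)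
    (hfA : ∀ y ∈ A, 0 ≤ f y ∧ f y ≤ C) :
    ∀ᵐ ω ∂P, ENNReal.ofReal (approxGMC γ X Km f ε ω A) = gmcMass γ X Km f ε A ω := by
  have hfin : ∫⁻ ω, gmcMass γ X Km f ε A ω ∂P < ⊤ := by
    have h := lintegral_mul_gmcMass (γ := γ) hX hdiag hf A (w := fun _ => 1) measurable_const
    simp only [one_mul, lintegral_gmcDensity hX hε] at h
    rw [h]
    calc ∫⁻ y in A, ENNReal.ofReal (f y) ≤ ∫⁻ y in A, ENNReal.ofReal C :=
          setLIntegral_mono measurable_const fun y hy => ENNReal.ofReal_le_ofReal (hfA y hy).2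
      _ < ⊤ := by
          rw [setLIntegral_const]
          exact ENNReal.mul_lt_top ENNReal.ofReal_lt_top hAv.lt_top
  filter_upwards [ae_lt_top (measurable_gmcMass hX hdiag hf A) hfin.ne] with ω hω
  have hmω : Measurable fun y => Real.exp (γ * X ε y ω - γ ^ 2 / 2 * Km ε ε y y) * f y := by
    have h1 : Measurable fun y => X ε y ω :=
      (hX.measurable_uncurry ε).comp (measurable_id.prodMk measurable_const)
    exact ((h1.const_mul γ).sub (hdiag.const_mul _)).exp.mul hf
  have hnn : 0 ≤ᵐ[volume.restrict A]
      fun y => Real.exp (γ * X ε y ω - γ ^ 2 / 2 * Km ε ε y y) * f y :=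
    (ae_restrict_iff' hA).2 (ae_of_all _ fun y hy => mul_nonneg (Real.exp_pos _).le (hfA y hy).1)
  have hint : Integrable (fun y => Real.exp (γ * X ε y ω - γ ^ 2 / 2 * Km ε ε y y) * f y)
      (volume.restrict A) :=
    ⟨hmω.aestronglyMeasurable, (hasFiniteIntegral_iff_ofReal hnn).2 hω⟩
  rw [approxGMC, ofReal_integral_eq_lintegral_ofReal hint hnn]
  rfl

/-- The expected chaos mass of a dyadic ball, tilted by the field at its centre. -/
lemma lintegral_exp_mul_gmcDensity_le {κ : ℝ} (hX : IsGaussianFamily P X Km)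
    (hκ : IsLogCovariance Km κ) (hdiag : ∀ ε, 0 < ε → Measurable fun y => Km ε ε y y)
    (hf : Measurable f) {C : ℝ} (hγ : 0 < γ) {x : EuclideanSpace ℝ (Fin d)} {n J : ℕ}
    (hJ : n ≤ J) (hfA : ∀ y ∈ Metric.closedBall x ((2 : ℝ) ^ n)⁻¹, 0 ≤ f y ∧ f y ≤ C) :
    ∫⁻ ω, ENNReal.ofReal (Real.exp (-γ * X ((2 : ℝ) ^ n)⁻¹ x ω)) *
      gmcMass γ X Km f ((2 : ℝ) ^ J)⁻¹ (Metric.closedBall x ((2 : ℝ) ^ n)⁻¹) ω ∂P ≤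
    ENNReal.ofReal (Real.exp (-((d + γ ^ 2 / 2) * n * Real.log 2))) *
      (ENNReal.ofReal (C * Real.exp (5 / 2 * γ ^ 2 * κ)) *
        volume (Metric.ball (0 : EuclideanSpace ℝ (Fin d)) 1)) := by
  set ε : ℝ := ((2 : ℝ) ^ J)⁻¹ with hε
  have hε0 : 0 < ε := by positivity
  have hN := hX.measurable_apply ((2 : ℝ) ^ n)⁻¹ x
  have hpt : ∀ y ∈ Metric.closedBall x ((2 : ℝ) ^ n)⁻¹,
      ∫⁻ ω, ENNReal.ofReal (Real.exp (-γ * X ((2 : ℝ) ^ n)⁻¹ x ω)) *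
        gmcDensity γ X Km f ε y ω ∂P ≤
      ENNReal.ofReal (C * Real.exp (5 / 2 * γ ^ 2 * κ - γ ^ 2 / 2 * n * Real.log 2)) := by
    intro y hy
    have hy' : dist x y ≤ ((2 : ℝ) ^ n)⁻¹ := by rw [dist_comm]; exact hy
    obtain ⟨q, hq, hE⟩ := hX.lintegral_exp_three hκ (k := 0) (by simpa using hJ) hy' (-γ) γ 0
      (-(γ ^ 2 / 2 * Km ε ε y y))
    have hdg : IsPairScale ε ε y y J := isPairScale_of_dist_le le_rfl (by simp)
    have hv := (abs_le.1 (hκ J ε ε hε0 hε0 y y hdg.1 hdg.2)).1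
    have hfy := hfA y hy
    have heq : ∀ ω, ENNReal.ofReal (Real.exp (-γ * X ((2 : ℝ) ^ n)⁻¹ x ω)) *
        gmcDensity γ X Km f ε y ω =
        ENNReal.ofReal (Real.exp (-γ * X ((2 : ℝ) ^ n)⁻¹ x ω + γ * X ((2 : ℝ) ^ J)⁻¹ y ω +
        0 * X ((2 : ℝ) ^ (n + 0))⁻¹ y ω + -(γ ^ 2 / 2 * Km ε ε y y))) * ENNReal.ofReal (f y) := by
      intro ω
      rw [gmcDensity, ← ENNReal.ofReal_mul (Real.exp_pos _).le,
        ← ENNReal.ofReal_mul (Real.exp_pos _).le, ← mul_assoc, ← Real.exp_add]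
      congr 3
      ring
    simp only [heq]
    rw [lintegral_mul_const' _ _ ENNReal.ofReal_ne_top, hE,
      ← ENNReal.ofReal_mul (Real.exp_pos _).le, mul_comm]
    refine ENNReal.ofReal_le_ofReal (mul_le_mul hfy.2 (Real.exp_le_exp.2 ?_) (Real.exp_pos _).le
      (hfy.1.trans hfy.2))
    rw [abs_neg, abs_of_pos hγ, abs_zero] at hq
    have hq' := (abs_le.1 hq).2
    have : γ ^ 2 / 2 * (J * Real.log 2 - κ) ≤ γ ^ 2 / 2 * Km ε ε y y := by gcongr; linarith
    push_cast
    linarith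
  rw [lintegral_mul_gmcMass hX (hdiag ε hε0) hf _ (hN.const_mul _).exp.ennreal_ofReal]
  refine (setLIntegral_mono measurable_const hpt).trans_eq ?_
  rw [setLIntegral_const, volume_closedBall_inv_two_pow, ← mul_assoc, ← mul_assoc]
  congr 1
  rw [← ENNReal.ofReal_mul' (Real.exp_pos _).le, ← ENNReal.ofReal_mul (Real.exp_pos _).le]
  congr 1
  rw [mul_assoc, ← Real.exp_add, mul_left_comm, ← Real.exp_add]
  ring_nf

variable {M : Ω → Measure (EuclideanSpace ℝ (Fin d))}

/-- The scales `2 ^ (-j)` tend to zero within `(0, 1]`. -/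
lemma tendsto_inv_two_pow :
    Tendsto (fun j : ℕ => ((2 : ℝ) ^ j)⁻¹) atTop (𝓝[Set.Ioc (0 : ℝ) 1] 0) := by
  refine tendsto_nhdsWithin_iff.2 ⟨?_, Eventually.of_forall fun j => ⟨by positivity,
    inv_le_one_of_one_le₀ (one_le_pow₀ one_le_two)⟩⟩
  simpa using tendsto_pow_atTop_nhds_zero_of_lt_one (r := (2 : ℝ)⁻¹) (by norm_num) (by norm_num)

lemma IsGMCMeasure.lintegral_exp_mul_le {κ : ℝ} (hX : IsGaussianFamily P X Km)
    (hκ : IsLogCovariance Km κ) (hdiag : ∀ ε, 0 < ε → Measurable fun y => Km ε ε y y)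
    (hM : IsGMCMeasure P γ X Km f D M)
    (hf : Measurable f) {C : ℝ} (hγ : 0 < γ) {x : EuclideanSpace ℝ (Fin d)} (n : ℕ)
    (hfD : ∀ y ∈ D, 0 ≤ f y ∧ f y ≤ C) (hD : Metric.closedBall x ((2 : ℝ) ^ n)⁻¹ ⊆ D) :
    ∫⁻ ω, ENNReal.ofReal (Real.exp (-γ * X ((2 : ℝ) ^ n)⁻¹ x ω)) *
      M ω (Metric.closedBall x ((2 : ℝ) ^ n)⁻¹) ∂P ≤
    ENNReal.ofReal (Real.exp (-((d + γ ^ 2 / 2) * n * Real.log 2))) *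
      (ENNReal.ofReal (C * Real.exp (5 / 2 * γ ^ 2 * κ)) *
        volume (Metric.ball (0 : EuclideanSpace ℝ (Fin d)) 1)) := by
  set A := Metric.closedBall x ((2 : ℝ) ^ n)⁻¹ with hA
  have hAm : MeasurableSet A := Metric.isClosed_closedBall.measurableSet
  have hAc : IsCompact (closure A) := by
    rw [Metric.isClosed_closedBall.closure_eq]; exact isCompact_closedBall _ _
  have hAD : closure A ⊆ D := by rwa [Metric.isClosed_closedBall.closure_eq]
  have htend := hM.2.2 A hAm hAc hAD
  have htend' : TendstoInMeasure P (fun (j : ℕ) ω => approxGMC γ X Km f ((2 : ℝ) ^ j)⁻¹ ω A) atTop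
      fun ω => (M ω A).toReal := fun δ hδ => (htend δ hδ).comp tendsto_inv_two_pow
  obtain ⟨ns, hns, hlim⟩ := htend'.exists_seq_tendsto_ae
  have hfA : ∀ y ∈ A, 0 ≤ f y ∧ f y ≤ C := fun y hy => hfD y (hD hy)
  have hIoc : ∀ j : ℕ, ((2 : ℝ) ^ j)⁻¹ ∈ Set.Ioc (0 : ℝ) 1 := fun j =>
    ⟨by positivity, inv_le_one_of_one_le₀ (one_le_pow₀ one_le_two)⟩
  have hae : ∀ᵐ ω ∂P, ∀ j : ℕ, ENNReal.ofReal (approxGMC γ X Km f ((2 : ℝ) ^ j)⁻¹ ω A) =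
      gmcMass γ X Km f ((2 : ℝ) ^ j)⁻¹ A ω :=
    ae_all_iff.2 fun j => ae_ofReal_approxGMC hX (hIoc j) (hdiag _ (hIoc j).1) hf hAm
      (isCompact_closedBall _ _).measure_ne_top hfA
  have hN := hX.measurable_apply ((2 : ℝ) ^ n)⁻¹ x
  calc ∫⁻ ω, ENNReal.ofReal (Real.exp (-γ * X ((2 : ℝ) ^ n)⁻¹ x ω)) * M ω A ∂P
      = ∫⁻ ω, liminf (fun i => ENNReal.ofReal (Real.exp (-γ * X ((2 : ℝ) ^ n)⁻¹ x ω)) *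
          gmcMass γ X Km f ((2 : ℝ) ^ (ns i))⁻¹ A ω) atTop ∂P := by
        refine lintegral_congr_ae ?_
        filter_upwards [hlim, hae] with ω h1 h2
        have h3 := ENNReal.tendsto_ofReal h1
        rw [ENNReal.ofReal_toReal (hM.2.1 ω A hAc hAD)] at h3
        simp only [h2] at h3
        exact ((ENNReal.Tendsto.const_mul h3 (Or.inr ENNReal.ofReal_ne_top)).liminf_eq).symm
    _ ≤ liminf (fun i => ∫⁻ ω, ENNReal.ofReal (Real.exp (-γ * X ((2 : ℝ) ^ n)⁻¹ x ω)) *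
          gmcMass γ X Km f ((2 : ℝ) ^ (ns i))⁻¹ A ω ∂P) atTop :=
        lintegral_liminf_le fun i => (hN.const_mul _).exp.ennreal_ofReal.mul
          (measurable_gmcMass hX (hdiag _ (hIoc _).1) hf A)
    _ ≤ _ := by
        refine liminf_le_of_frequently_le' (Eventually.frequently ?_)
        filter_upwards [eventually_ge_atTop n] with i hi
        exact lintegral_exp_mul_gmcDensity_le hX hκ hdiag hf hγ
          (hi.trans (hns.le_apply)) hfA

end Mass

lemma tsum_ofReal_exp_neg_lt_top {c : ℝ} (hc : 0 < c) :
    ∑' n : ℕ, ENNReal.ofReal (Real.exp (-(c * n))) < ⊤ := by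
  have h : Summable fun n : ℕ => Real.exp (n * -c) :=
    Real.summable_exp_nat_mul_iff.2 (neg_lt_zero.2 hc)
  have h2 := h.tsum_ofReal_lt_top
  simpa [mul_comm] using h2

section UpperHalf

variable {Ω : Type*} [MeasurableSpace Ω] {P : Measure Ω} [IsProbabilityMeasure P]
  {X : ℝ → EuclideanSpace ℝ (Fin d) → Ω → ℝ}
  {Km : ℝ → ℝ → EuclideanSpace ℝ (Fin d) → EuclideanSpace ℝ (Fin d) → ℝ}
  {γ : ℝ} {f : EuclideanSpace ℝ (Fin d) → ℝ} {D : Set (EuclideanSpace ℝ (Fin d))}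
  {M : Ω → Measure (EuclideanSpace ℝ (Fin d))}

lemma closedBall_inv_two_pow_subset (x : EuclideanSpace ℝ (Fin d)) (n : ℕ) :
    Metric.closedBall x ((2 : ℝ) ^ n)⁻¹ ⊆ Metric.closedBall x 1 :=
  Metric.closedBall_subset_closedBall (inv_le_one_of_one_le₀ (one_le_pow₀ one_le_two))

lemma IsGMCMeasure.ae_tsum_lt_top {κ : ℝ} (hX : IsGaussianFamily P X Km)
    (hκ : IsLogCovariance Km κ) (hdiag : ∀ ε, 0 < ε → Measurable fun y => Km ε ε y y)
    (hM : IsGMCMeasure P γ X Km f D M)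
    (hf : Measurable f) {C : ℝ} (hγ : 0 < γ) {x : EuclideanSpace ℝ (Fin d)}
    (hfD : ∀ y ∈ D, 0 ≤ f y ∧ f y ≤ C) (hD : Metric.closedBall x 1 ⊆ D)
    {β : ℝ} (hβ : β < d + γ ^ 2 / 2) :
    ∀ᵐ ω ∂P, ∑' n : ℕ, ENNReal.ofReal (Real.exp (β * n * Real.log 2)) *
      M ω (Metric.closedBall x ((2 : ℝ) ^ n)⁻¹) < ⊤ := by
  have hlog : 0 < Real.log 2 := Real.log_pos one_lt_two
  obtain ⟨δ, hδ0, hδ⟩ : ∃ δ, 0 < δ ∧ β + δ < d + γ ^ 2 / 2 :=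
    ⟨(d + γ ^ 2 / 2 - β) / 2, by linarith, by linarith⟩
  have hN : ∀ n : ℕ, Measurable (X ((2 : ℝ) ^ n)⁻¹ x) := fun n => hX.measurable_apply _ x
  have hMm : ∀ n : ℕ, Measurable fun ω => M ω (Metric.closedBall x ((2 : ℝ) ^ n)⁻¹) := fun n =>
    hM.1 _ Metric.isClosed_closedBall.measurableSet
  have h1 : ∀ᵐ ω ∂P, ∑' n : ℕ, ENNReal.ofReal (Real.exp ((β + δ) * n * Real.log 2)) *
      (ENNReal.ofReal (Real.exp (-γ * X ((2 : ℝ) ^ n)⁻¹ x ω)) *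
        M ω (Metric.closedBall x ((2 : ℝ) ^ n)⁻¹)) < ⊤ := by
    have hm : ∀ n : ℕ, Measurable fun ω => ENNReal.ofReal (Real.exp ((β + δ) * n * Real.log 2)) *
        (ENNReal.ofReal (Real.exp (-γ * X ((2 : ℝ) ^ n)⁻¹ x ω)) *
          M ω (Metric.closedBall x ((2 : ℝ) ^ n)⁻¹)) := fun n =>
      (((hN n).const_mul _).exp.ennreal_ofReal.mul (hMm n)).const_mul _
    refine ae_lt_top (Measurable.tsum hm) (ne_of_lt ?_)
    rw [lintegral_tsum fun n => (hm n).aemeasurable]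
    set V := ENNReal.ofReal (C * Real.exp (5 / 2 * γ ^ 2 * κ)) *
        volume (Metric.ball (0 : EuclideanSpace ℝ (Fin d)) 1)
    calc _ ≤ ∑' n : ℕ, ENNReal.ofReal
            (Real.exp (-(((d + γ ^ 2 / 2 - (β + δ)) * Real.log 2) * n))) * V := by
          refine ENNReal.tsum_le_tsum fun n => ?_
          rw [lintegral_const_mul' _ _ ENNReal.ofReal_ne_top]
          refine (mul_le_mul_right (hM.lintegral_exp_mul_le hX hκ hdiag hf hγ n hfD
            ((closedBall_inv_two_pow_subset x n).trans hD)) _).trans_eq ?_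
          rw [← mul_assoc, ← ENNReal.ofReal_mul (Real.exp_pos _).le, ← Real.exp_add]
          congr 3
          ring
      _ < ⊤ := by
          rw [ENNReal.tsum_mul_right]
          exact ENNReal.mul_lt_top
            (tsum_ofReal_exp_neg_lt_top (mul_pos (by linarith) hlog))
            (ENNReal.mul_lt_top ENNReal.ofReal_lt_top measure_ball_lt_top)
  have h2 : ∀ᵐ ω ∂P, ∑' n : ℕ, ENNReal.ofReal (Real.exp
      ((γ * X ((2 : ℝ) ^ n)⁻¹ x ω - δ * n * Real.log 2) * (δ / γ ^ 2))) < ⊤ := by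
    have hm : ∀ n : ℕ, Measurable fun ω => ENNReal.ofReal (Real.exp
        ((γ * X ((2 : ℝ) ^ n)⁻¹ x ω - δ * n * Real.log 2) * (δ / γ ^ 2))) := fun n =>
      ((((hN n).const_mul _).sub_const _).mul_const _).exp.ennreal_ofReal
    refine ae_lt_top (Measurable.tsum hm) (ne_of_lt ?_)
    rw [lintegral_tsum fun n => (hm n).aemeasurable]
    calc _ ≤ ∑' n : ℕ, ENNReal.ofReal (Real.exp (-((δ ^ 2 / (2 * γ ^ 2) * Real.log 2) * n))) *
            ENNReal.ofReal (Real.exp (κ * (δ / γ) ^ 2 / 2)) := by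
          refine ENNReal.tsum_le_tsum fun n => ?_
          obtain ⟨q, hq, hE⟩ := hX.lintegral_exp_three hκ (k := 0) (J := n) (n := n) (x := x)
            (y := x) (by simp) (by simp) (δ / γ) 0 0 (-(δ * n * Real.log 2 * (δ / γ ^ 2)))
          have heq : ∀ ω, (γ * X ((2 : ℝ) ^ n)⁻¹ x ω - δ * n * Real.log 2) * (δ / γ ^ 2) =
              δ / γ * X ((2 : ℝ) ^ n)⁻¹ x ω + 0 * X ((2 : ℝ) ^ n)⁻¹ x ω +
                0 * X ((2 : ℝ) ^ (n + 0))⁻¹ x ω + -(δ * n * Real.log 2 * (δ / γ ^ 2)) := by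
            intro ω; field_simp; ring
          simp only [heq]
          rw [hE, ← ENNReal.ofReal_mul (Real.exp_pos _).le, ← Real.exp_add]
          have hq' := (abs_le.1 hq).2
          rw [abs_of_pos (div_pos hδ0 hγ), abs_zero, add_zero, add_zero] at hq'
          refine ENNReal.ofReal_le_ofReal (Real.exp_le_exp.2 ?_)
          have : δ ^ 2 / (2 * γ ^ 2) * Real.log 2 * n = δ * n * Real.log 2 * (δ / γ ^ 2) / 2 := by
            field_simp
          have h3 : (δ / γ) ^ 2 * n * Real.log 2 = δ * n * Real.log 2 * (δ / γ ^ 2) := by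
            field_simp
          push_cast
          linarith
      _ < ⊤ := by
          rw [ENNReal.tsum_mul_right]
          exact ENNReal.mul_lt_top (tsum_ofReal_exp_neg_lt_top (by positivity))
            ENNReal.ofReal_lt_top
  filter_upwards [h1, h2] with ω hω1 hω2
  set S := ∑' n : ℕ, ENNReal.ofReal (Real.exp
      ((γ * X ((2 : ℝ) ^ n)⁻¹ x ω - δ * n * Real.log 2) * (δ / γ ^ 2))) with hS
  have hq : 0 < δ / γ ^ 2 := by positivity
  refine lt_of_le_of_lt (ENNReal.tsum_le_tsum (g := fun n : ℕ => S ^ (δ / γ ^ 2)⁻¹ *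
    (ENNReal.ofReal (Real.exp ((β + δ) * n * Real.log 2)) *
      (ENNReal.ofReal (Real.exp (-γ * X ((2 : ℝ) ^ n)⁻¹ x ω)) *
        M ω (Metric.closedBall x ((2 : ℝ) ^ n)⁻¹)))) fun n => ?_) ?_
  · have hle : ENNReal.ofReal (Real.exp (γ * X ((2 : ℝ) ^ n)⁻¹ x ω - δ * n * Real.log 2)) ≤
        S ^ (δ / γ ^ 2)⁻¹ := by
      rw [ENNReal.le_rpow_inv_iff hq, ENNReal.ofReal_rpow_of_pos (Real.exp_pos _), ← Real.exp_mul]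
      exact ENNReal.le_tsum n
    refine le_trans (le_of_eq ?_) (mul_le_mul_left hle _)
    rw [← mul_assoc, ← mul_assoc, ← ENNReal.ofReal_mul (Real.exp_pos _).le, ← Real.exp_add,
      ← ENNReal.ofReal_mul (Real.exp_pos _).le, ← Real.exp_add]
    ring_nf
  · rw [ENNReal.tsum_mul_left]
    exact ENNReal.mul_lt_top (ENNReal.rpow_lt_top_of_nonneg (by positivity) hω2.ne) hω1

lemma ofReal_dist_rpow_le_tsum {β : ℝ} (hβ : 0 < β) {x y : EuclideanSpace ℝ (Fin d)}
    (hy : y ∈ Metric.ball x 1) :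
    ENNReal.ofReal (dist y x) ^ (-β) ≤ ∑' n : ℕ, ENNReal.ofReal (Real.exp (β * (n + 1) *
      Real.log 2)) * (Metric.closedBall x ((2 : ℝ) ^ n)⁻¹).indicator 1 y := by
  have hlog : 0 < Real.log 2 := Real.log_pos one_lt_two
  rcases eq_or_ne y x with rfl | hne
  · refine le_top.trans_eq (Eq.symm ?_)
    refine top_le_iff.1 ?_
    rw [← ENNReal.tsum_const_eq_top_of_ne_zero (α := ℕ) (one_ne_zero)]
    refine ENNReal.tsum_le_tsum fun n => ?_
    rw [Set.indicator_of_mem (Metric.mem_closedBall_self (by positivity)), Pi.one_apply, mul_one,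
      ENNReal.one_le_ofReal, Real.one_le_exp_iff]
    positivity
  · have hpos : 0 < dist y x := dist_pos.2 hne
    obtain ⟨n, hn1, hn2⟩ := exists_nat_pow_near_of_lt_one hpos (Metric.mem_ball.1 hy).le
      (y := (2 : ℝ)⁻¹) (by norm_num) (by norm_num)
    refine le_trans ?_ (ENNReal.le_tsum n)
    rw [inv_pow] at hn1 hn2
    rw [Set.indicator_of_mem (Metric.mem_closedBall.2 hn2), Pi.one_apply, mul_one,
      ENNReal.ofReal_rpow_of_pos hpos]
    refine ENNReal.ofReal_le_ofReal ?_
    rw [Real.rpow_def_of_pos hpos, Real.exp_le_exp]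
    have h1 := Real.log_lt_log (by positivity) hn1
    rw [Real.log_inv, Real.log_pow] at h1
    push_cast at h1
    nlinarith

lemma IsGMCMeasure.ae_lintegral_lt_top {κ : ℝ} (hX : IsGaussianFamily P X Km)
    (hκ : IsLogCovariance Km κ) (hdiag : ∀ ε, 0 < ε → Measurable fun y => Km ε ε y y)
    (hM : IsGMCMeasure P γ X Km f D M)
    (hf : Measurable f) {C : ℝ} (hγ : 0 < γ) {x : EuclideanSpace ℝ (Fin d)}
    (hfD : ∀ y ∈ D, 0 ≤ f y ∧ f y ≤ C) (hD : Metric.closedBall x 1 ⊆ D)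
    {β : ℝ} (hβ : β < d + γ ^ 2 / 2) :
    ∀ᵐ ω ∂P, ∫⁻ y in Metric.ball x 1, ENNReal.ofReal (dist y x) ^ (-β) ∂(M ω) < ⊤ := by
  rcases le_or_gt β 0 with hβ0 | hβ0
  · refine ae_of_all _ fun ω => ?_
    have hfin : M ω (Metric.closedBall x 1) ≠ ⊤ := by
      refine hM.2.1 ω _ ?_ ?_ <;> rw [Metric.isClosed_closedBall.closure_eq]
      exacts [isCompact_closedBall _ _, hD]
    calc _ ≤ ∫⁻ y in Metric.ball x 1, 1 ∂(M ω) := by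
          refine setLIntegral_mono measurable_const fun y hy => ?_
          refine ENNReal.rpow_le_one ?_ (by linarith)
          exact ENNReal.ofReal_le_one.2 (Metric.mem_ball.1 hy).le
      _ ≤ M ω (Metric.closedBall x 1) := by
          rw [setLIntegral_one]; exact measure_mono Metric.ball_subset_closedBall
      _ < ⊤ := hfin.lt_top
  · filter_upwards [hM.ae_tsum_lt_top hX hκ hdiag hf hγ hfD hD hβ] with ω hω
    have hms : ∀ n : ℕ, MeasurableSet (Metric.closedBall x ((2 : ℝ) ^ n)⁻¹) := fun n =>
      Metric.isClosed_closedBall.measurableSet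
    have hm : ∀ n : ℕ, Measurable fun y => ENNReal.ofReal (Real.exp (β * (n + 1) *
        Real.log 2)) * (Metric.closedBall x ((2 : ℝ) ^ n)⁻¹).indicator 1 y := fun n =>
      (measurable_one.indicator (hms n)).const_mul _
    calc _ ≤ ∫⁻ y in Metric.ball x 1, ∑' n : ℕ, ENNReal.ofReal (Real.exp (β * (n + 1) *
          Real.log 2)) * (Metric.closedBall x ((2 : ℝ) ^ n)⁻¹).indicator 1 y ∂(M ω) :=
          setLIntegral_mono (Measurable.tsum hm) fun y hy =>
            ofReal_dist_rpow_le_tsum hβ0 hy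
      _ ≤ ∫⁻ y, ∑' n : ℕ, ENNReal.ofReal (Real.exp (β * (n + 1) *
          Real.log 2)) * (Metric.closedBall x ((2 : ℝ) ^ n)⁻¹).indicator 1 y ∂(M ω) :=
          setLIntegral_le_lintegral _ _
      _ = ∑' n : ℕ, ENNReal.ofReal (Real.exp (β * Real.log 2)) *
          (ENNReal.ofReal (Real.exp (β * n * Real.log 2)) *
            M ω (Metric.closedBall x ((2 : ℝ) ^ n)⁻¹)) := by
          rw [lintegral_tsum fun n => (hm n).aemeasurable]
          refine tsum_congr fun n => ?_
          rw [lintegral_const_mul' _ _ ENNReal.ofReal_ne_top, lintegral_indicator_one (hms n),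
            ← mul_assoc, ← ENNReal.ofReal_mul (Real.exp_pos _).le, ← Real.exp_add]
          ring_nf
      _ < ⊤ := by
          rw [ENNReal.tsum_mul_left]
          exact ENNReal.mul_lt_top ENNReal.ofReal_lt_top hω

end UpperHalf

section Truncation

variable {Ω : Type*} [MeasurableSpace Ω] {P : Measure Ω}

/-- The logarithm of the density of the approximate chaos at scale `2 ^ (-J)` near `x`, rescaled
to the ball of radius `2 ^ (-n)` and with the contribution of the field at `x` removed. -/
def rescaledExp (γ : ℝ) (X : ℝ → EuclideanSpace ℝ (Fin d) → Ω → ℝ)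
    (Km : ℝ → ℝ → EuclideanSpace ℝ (Fin d) → EuclideanSpace ℝ (Fin d) → ℝ)
    (x : EuclideanSpace ℝ (Fin d)) (n J : ℕ) (y : EuclideanSpace ℝ (Fin d)) (ω : Ω) : ℝ :=
  (d + γ ^ 2 / 2) * n * Real.log 2 + γ * (X ((2 : ℝ) ^ J)⁻¹ y ω - X ((2 : ℝ) ^ n)⁻¹ x ω) -
    γ ^ 2 / 2 * Km ((2 : ℝ) ^ J)⁻¹ ((2 : ℝ) ^ J)⁻¹ y y

/-- The increments of the field at `y` from scale `2 ^ (-n)` to scale `2 ^ (-(n + k))`, `k ≤ K`,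
grow at rate at most `γ + δ`. -/
def thinPoints (γ δ b : ℝ) (X : ℝ → EuclideanSpace ℝ (Fin d) → Ω → ℝ)
    (x : EuclideanSpace ℝ (Fin d)) (n K : ℕ) : Set (EuclideanSpace ℝ (Fin d) × Ω) :=
  {p | ∀ k ∈ Finset.range (K + 1),
    X ((2 : ℝ) ^ (n + k))⁻¹ p.1 p.2 - X ((2 : ℝ) ^ n)⁻¹ x p.2 ≤ (γ + δ) * k * Real.log 2 + b}

/-- The rescaled density restricted to thin points. -/
def thinDensity (γ δ b : ℝ) (X : ℝ → EuclideanSpace ℝ (Fin d) → Ω → ℝ)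
    (Km : ℝ → ℝ → EuclideanSpace ℝ (Fin d) → EuclideanSpace ℝ (Fin d) → ℝ)
    (f : EuclideanSpace ℝ (Fin d) → ℝ) (x : EuclideanSpace ℝ (Fin d)) (n K : ℕ) :
    EuclideanSpace ℝ (Fin d) × Ω → ℝ≥0∞ :=
  (thinPoints γ δ b X x n K).indicator fun p =>
    ENNReal.ofReal (Real.exp (rescaledExp γ X Km x n (n + K) p.1 p.2) * f p.1)

/-- The Cameron–Martin weight attached to the field at `x` and scale `2 ^ (-n)`. -/
def tilt (X : ℝ → EuclideanSpace ℝ (Fin d) → Ω → ℝ) (x : EuclideanSpace ℝ (Fin d)) (n : ℕ) (s : ℝ)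
    (ω : Ω) : ℝ≥0∞ :=
  ENNReal.ofReal (Real.exp (s * X ((2 : ℝ) ^ n)⁻¹ x ω - s ^ 2 * n * Real.log 2 / 2))

variable {X : ℝ → EuclideanSpace ℝ (Fin d) → Ω → ℝ}
  {Km : ℝ → ℝ → EuclideanSpace ℝ (Fin d) → EuclideanSpace ℝ (Fin d) → ℝ}
  {γ δ b κ : ℝ} {f : EuclideanSpace ℝ (Fin d) → ℝ} {D : Set (EuclideanSpace ℝ (Fin d))}
  {x : EuclideanSpace ℝ (Fin d)} {n K : ℕ}

lemma measurable_tilt (hX : IsGaussianFamily P X Km) (s : ℝ) : Measurable (tilt X x n s) :=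
  (((hX.measurable_apply _ _).const_mul _).sub_const _).exp.ennreal_ofReal

lemma measurable_rescaledExp (hX : IsGaussianFamily P X Km)
    (hdiag : ∀ ε, 0 < ε → Measurable fun y => Km ε ε y y) (J : ℕ) :
    Measurable fun p : EuclideanSpace ℝ (Fin d) × Ω => rescaledExp γ X Km x n J p.1 p.2 := by
  have h1 := hX.measurable_uncurry ((2 : ℝ) ^ J)⁻¹
  have h2 := (hX.measurable_apply ((2 : ℝ) ^ n)⁻¹ x).comp
    (measurable_snd : Measurable (Prod.snd : EuclideanSpace ℝ (Fin d) × Ω → Ω))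
  have h3 := (hdiag ((2 : ℝ) ^ J)⁻¹ (by positivity)).comp
    (measurable_fst : Measurable (Prod.fst : EuclideanSpace ℝ (Fin d) × Ω → _))
  exact (((h1.sub h2).const_mul γ).const_add _).sub (h3.const_mul _)

lemma measurableSet_thinPoints (hX : IsGaussianFamily P X Km) :
    MeasurableSet (thinPoints γ δ b X x n K) := by
  have h2 := (hX.measurable_apply ((2 : ℝ) ^ n)⁻¹ x).comp
    (measurable_snd : Measurable (Prod.snd : EuclideanSpace ℝ (Fin d) × Ω → Ω))
  have h : thinPoints γ δ b X x n K = ⋂ k ∈ Finset.range (K + 1),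
      {p : EuclideanSpace ℝ (Fin d) × Ω | X ((2 : ℝ) ^ (n + k))⁻¹ p.1 p.2 -
        X ((2 : ℝ) ^ n)⁻¹ x p.2 ≤ (γ + δ) * k * Real.log 2 + b} := by
    ext p; simp only [thinPoints, Set.mem_ofPred_eq, Set.mem_iInter]
  rw [h]
  exact Finset.measurableSet_biInter _ fun k _ =>
    measurableSet_le ((hX.measurable_uncurry _).sub h2) measurable_const

lemma measurable_thinDensity (hX : IsGaussianFamily P X Km)
    (hdiag : ∀ ε, 0 < ε → Measurable fun y => Km ε ε y y) (hf : Measurable f) :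
    Measurable (thinDensity γ δ b X Km f x n K) :=
  Measurable.indicator ((measurable_rescaledExp hX hdiag _).exp.mul
    (hf.comp measurable_fst)).ennreal_ofReal (measurableSet_thinPoints hX)

set_option linter.unusedSectionVars false in
lemma ofReal_exp_rescaledExp (J : ℕ) (y : EuclideanSpace ℝ (Fin d)) (ω : Ω) :
    ENNReal.ofReal (Real.exp (rescaledExp γ X Km x n J y ω) * f y) =
      ENNReal.ofReal (Real.exp ((d + γ ^ 2 / 2) * n * Real.log 2 - γ * X ((2 : ℝ) ^ n)⁻¹ x ω)) *
        gmcDensity γ X Km f ((2 : ℝ) ^ J)⁻¹ y ω := by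
  rw [gmcDensity, ← ENNReal.ofReal_mul (Real.exp_pos _).le, ← mul_assoc, ← Real.exp_add,
    rescaledExp]
  ring_nf

variable [IsProbabilityMeasure P]

lemma IsLogCovariance.abs_diag_le (hκ : IsLogCovariance Km κ) (J : ℕ)
    (y : EuclideanSpace ℝ (Fin d)) :
    |Km ((2 : ℝ) ^ J)⁻¹ ((2 : ℝ) ^ J)⁻¹ y y - J * Real.log 2| ≤ κ := by
  have h := isPairScale_of_dist_le (y := y) (z := y) (ε := ((2 : ℝ) ^ J)⁻¹) le_rfl (by simp)
  exact hκ J _ _ (by positivity) (by positivity) y y h.1 h.2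

/-- Expectation of the tilted rescaled density, biased further by the increment of the field at
an intermediate scale. -/
lemma lintegral_tilt_rescaledExp (hX : IsGaussianFamily P X Km) (hκ : IsLogCovariance Km κ)
    (hγ : 0 < γ) (hδ : 0 ≤ δ) {s : ℝ} (hs : |s| ≤ 1) {k : ℕ} (hk : k ≤ K)
    {y : EuclideanSpace ℝ (Fin d)} (hy : y ∈ Metric.closedBall x ((2 : ℝ) ^ n)⁻¹) (t : ℝ) :
    ∃ q : ℝ, |q| ≤ κ * (1 + 2 * γ + 2 * δ) ^ 2 / 2 + γ ^ 2 / 2 * κ ∧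
    ∫⁻ ω, tilt X x n s ω * ENNReal.ofReal (Real.exp (rescaledExp γ X Km x n (n + K) y ω) *
      Real.exp (δ * (X ((2 : ℝ) ^ (n + k))⁻¹ y ω - X ((2 : ℝ) ^ n)⁻¹ x ω) + t)) ∂P =
    ENNReal.ofReal (Real.exp (d * n * Real.log 2 + (δ ^ 2 + 2 * γ * δ) * k * Real.log 2 / 2 +
      t + q)) := by
  have hκ0 : 0 ≤ κ := (abs_nonneg _).trans (hκ.abs_diag_le 0 y)
  have hy' : dist x y ≤ ((2 : ℝ) ^ n)⁻¹ := by rw [dist_comm]; exact hy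
  set v := Km ((2 : ℝ) ^ (n + K))⁻¹ ((2 : ℝ) ^ (n + K))⁻¹ y y with hv
  have hvb := abs_le.1 (hκ.abs_diag_le (n + K) y)
  obtain ⟨q, hq, hE⟩ := hX.lintegral_exp_three hκ (Nat.add_le_add_left hk n) hy' (s - γ - δ) γ δ
    ((d + γ ^ 2 / 2) * n * Real.log 2 - γ ^ 2 / 2 * v - s ^ 2 * n * Real.log 2 / 2 + t)
  refine ⟨q / 2 + γ ^ 2 / 2 * ((n + K : ℕ) * Real.log 2 - v), ?_, ?_⟩
  · have h1 : |s - γ - δ| + |γ| + |δ| ≤ 1 + 2 * γ + 2 * δ := by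
      rw [abs_of_pos hγ, abs_of_nonneg hδ]
      have := abs_le.1 hs
      have : |s - γ - δ| ≤ 1 + γ + δ := abs_le.2 ⟨by linarith, by linarith⟩
      linarith
    have h2 : |q| ≤ κ * (1 + 2 * γ + 2 * δ) ^ 2 := hq.trans (by gcongr)
    have h3 := abs_le.1 h2
    have h4 : |γ ^ 2 / 2 * ((n + K : ℕ) * Real.log 2 - v)| ≤ γ ^ 2 / 2 * κ := by
      rw [abs_mul, abs_of_nonneg (by positivity : 0 ≤ γ ^ 2 / 2), abs_sub_comm]
      exact mul_le_mul_of_nonneg_left (hκ.abs_diag_le (n + K) y) (by positivity)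
    have h5 := abs_le.1 h4
    exact abs_le.2 ⟨by linarith, by linarith⟩
  · convert hE using 2
    · ext ω
      rw [tilt, ← Real.exp_add, ← ENNReal.ofReal_mul (Real.exp_pos _).le, ← Real.exp_add,
        rescaledExp, ← hv]
      congr 2
      ring
    · push_cast
      congr 1
      ring

/-- Upper bound for the correlation of the tilted densities at two thin points. -/
lemma lintegral_tilt_sq_thinDensity_le (hX : IsGaussianFamily P X Km) (hκ : IsLogCovariance Km κ)
    (hγ : 0 < γ) {C : ℝ} {s : ℝ} (hs : |s| ≤ 1) {k : ℕ} (hk : k ≤ K)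
    {y z : EuclideanSpace ℝ (Fin d)} (hy : y ∈ Metric.closedBall x ((2 : ℝ) ^ n)⁻¹)
    (hz : z ∈ Metric.closedBall x ((2 : ℝ) ^ n)⁻¹)
    (hyz : IsPairScale ((2 : ℝ) ^ (n + K))⁻¹ ((2 : ℝ) ^ (n + K))⁻¹ y z (n + k))
    (hfy : 0 ≤ f y ∧ f y ≤ C) (hfz : 0 ≤ f z ∧ f z ≤ C) :
    ∫⁻ ω, tilt X x n s ω ^ 2 * (thinDensity γ δ b X Km f x n K (y, ω) *
      thinDensity γ δ b X Km f x n K (z, ω)) ∂P ≤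
    ENNReal.ofReal (C ^ 2 * Real.exp (s ^ 2 * n * Real.log 2 + 2 * d * n * Real.log 2 +
      (γ ^ 2 / 2 + γ * δ) * k * Real.log 2 + γ * b + κ * (2 + 4 * γ) ^ 2 / 2 + γ ^ 2 * κ)) := by
  have hκ0 : 0 ≤ κ := (abs_nonneg _).trans (hκ.abs_diag_le 0 y)
  have hC : 0 ≤ C := hfy.1.trans hfy.2
  have hy' : dist x y ≤ ((2 : ℝ) ^ n)⁻¹ := by rw [dist_comm]; exact hy
  have hz' : dist x z ≤ ((2 : ℝ) ^ n)⁻¹ := by rw [dist_comm]; exact hz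
  set v := Km ((2 : ℝ) ^ (n + K))⁻¹ ((2 : ℝ) ^ (n + K))⁻¹ y y with hv
  set w := Km ((2 : ℝ) ^ (n + K))⁻¹ ((2 : ℝ) ^ (n + K))⁻¹ z z with hw
  have hvb := abs_le.1 (hκ.abs_diag_le (n + K) y)
  have hwb := abs_le.1 (hκ.abs_diag_le (n + K) z)
  set t := 2 * ((d + γ ^ 2 / 2) * n * Real.log 2) - γ ^ 2 / 2 * v - γ ^ 2 / 2 * w -
    s ^ 2 * n * Real.log 2 + γ * ((γ + δ) * k * Real.log 2 + b) with ht
  have hE := hX.lintegral_exp_four_le hκ (Nat.add_le_add_left hk n) hy' hz' hyz (2 * s - γ) γ γ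
    (-γ) t
  have hpt : ∀ ω, tilt X x n s ω ^ 2 * (thinDensity γ δ b X Km f x n K (y, ω) *
      thinDensity γ δ b X Km f x n K (z, ω)) ≤ ENNReal.ofReal (C ^ 2) *
      ENNReal.ofReal (Real.exp ((2 * s - γ) * X ((2 : ℝ) ^ n)⁻¹ x ω +
        γ * X ((2 : ℝ) ^ (n + K))⁻¹ y ω + γ * X ((2 : ℝ) ^ (n + K))⁻¹ z ω +
        -γ * X ((2 : ℝ) ^ (n + k))⁻¹ y ω + t)) := by
    intro ω
    by_cases hyt : (y, ω) ∈ thinPoints γ δ b X x n K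
    swap
    · simp [thinDensity, hyt]
    by_cases hzt : (z, ω) ∈ thinPoints γ δ b X x n K
    swap
    · simp [thinDensity, hzt]
    rw [thinDensity, Set.indicator_of_mem hyt, Set.indicator_of_mem hzt, tilt, pow_two,
      ← ENNReal.ofReal_mul (Real.exp_pos _).le,
      ← ENNReal.ofReal_mul (mul_nonneg (Real.exp_pos _).le hfy.1),
      ← ENNReal.ofReal_mul (by positivity), ← ENNReal.ofReal_mul (by positivity)]
    refine ENNReal.ofReal_le_ofReal ?_
    have hthin := hyt k (Finset.mem_range.2 (by omega))
    have hff : f y * f z ≤ C ^ 2 := by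
      rw [pow_two]; exact mul_le_mul hfy.2 hfz.2 hfz.1 hC
    calc _ = (f y * f z) * Real.exp ((s * X ((2 : ℝ) ^ n)⁻¹ x ω - s ^ 2 * n * Real.log 2 / 2) +
          (s * X ((2 : ℝ) ^ n)⁻¹ x ω - s ^ 2 * n * Real.log 2 / 2) +
          rescaledExp γ X Km x n (n + K) y ω + rescaledExp γ X Km x n (n + K) z ω) := by
          simp only [Real.exp_add]; ring
      _ ≤ _ := by
          refine mul_le_mul hff (Real.exp_le_exp.2 ?_) (Real.exp_pos _).le (by positivity)
          simp only [rescaledExp, ← hv, ← hw, ht]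
          have := mul_le_mul_of_nonneg_left hthin hγ.le
          simp only at this
          linarith
  refine (lintegral_mono hpt).trans ?_
  rw [lintegral_const_mul' _ _ ENNReal.ofReal_ne_top, ENNReal.ofReal_mul (by positivity)]
  refine mul_le_mul_right (hE.trans (ENNReal.ofReal_le_ofReal (Real.exp_le_exp.2 ?_))) _
  have h1 : |2 * s - γ| + |γ| + |γ| + |-γ| ≤ 2 + 4 * γ := by
    rw [abs_neg, abs_of_pos hγ]
    have := abs_le.1 hs
    have : |2 * s - γ| ≤ 2 + γ := abs_le.2 ⟨by linarith, by linarith⟩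
    linarith
  have h2 : κ * (|2 * s - γ| + |γ| + |γ| + |-γ|) ^ 2 ≤ κ * (2 + 4 * γ) ^ 2 := by gcongr
  have h3 : γ ^ 2 / 2 * ((n + K : ℕ) * Real.log 2 - κ) ≤ γ ^ 2 / 2 * v := by
    gcongr; linarith
  have h4 : γ ^ 2 / 2 * ((n + K : ℕ) * Real.log 2 - κ) ≤ γ ^ 2 / 2 * w := by
    gcongr; linarith
  push_cast at *
  rw [ht]
  linarith

end Truncation

section Moments

variable {Ω : Type*} [MeasurableSpace Ω] {P : Measure Ω}
  {X : ℝ → EuclideanSpace ℝ (Fin d) → Ω → ℝ}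
  {Km : ℝ → ℝ → EuclideanSpace ℝ (Fin d) → EuclideanSpace ℝ (Fin d) → ℝ}
  {γ δ b κ : ℝ} {f : EuclideanSpace ℝ (Fin d) → ℝ} {x : EuclideanSpace ℝ (Fin d)} {n K : ℕ}

/-- The rescaled mass of the thin points of the ball of radius `2 ^ (-n)`. -/
def thinMass (γ δ b : ℝ) (X : ℝ → EuclideanSpace ℝ (Fin d) → Ω → ℝ)
    (Km : ℝ → ℝ → EuclideanSpace ℝ (Fin d) → EuclideanSpace ℝ (Fin d) → ℝ)
    (f : EuclideanSpace ℝ (Fin d) → ℝ) (x : EuclideanSpace ℝ (Fin d)) (n K : ℕ) (ω : Ω) : ℝ≥0∞ :=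
  ∫⁻ y in Metric.closedBall x ((2 : ℝ) ^ n)⁻¹, thinDensity γ δ b X Km f x n K (y, ω)

lemma measurable_thinMass (hX : IsGaussianFamily P X Km)
    (hdiag : ∀ ε, 0 < ε → Measurable fun y => Km ε ε y y) (hf : Measurable f) :
    Measurable (thinMass γ δ b X Km f x n K) :=
  Measurable.lintegral_prod_right' (f := fun p : Ω × EuclideanSpace ℝ (Fin d) =>
    thinDensity γ δ b X Km f x n K (p.2, p.1))
    ((measurable_thinDensity hX hdiag hf).comp measurable_swap)

lemma thinMass_le (ω : Ω) :
    thinMass γ δ b X Km f x n K ω ≤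
      ENNReal.ofReal (Real.exp ((d + γ ^ 2 / 2) * n * Real.log 2 - γ * X ((2 : ℝ) ^ n)⁻¹ x ω)) *
        gmcMass γ X Km f ((2 : ℝ) ^ (n + K))⁻¹ (Metric.closedBall x ((2 : ℝ) ^ n)⁻¹) ω := by
  rw [gmcMass, ← lintegral_const_mul' _ _ ENNReal.ofReal_ne_top]
  refine lintegral_mono fun y => ?_
  rw [← ofReal_exp_rescaledExp]
  exact Set.indicator_le_self' (fun _ _ => zero_le) _

variable [IsProbabilityMeasure P]

/-- Thin points carry at least half of the tilted first moment, up to constants. -/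
lemma le_lintegral_tilt_thinDensity (hX : IsGaussianFamily P X Km) (hκ : IsLogCovariance Km κ)
    (hdiag : ∀ ε, 0 < ε → Measurable fun y => Km ε ε y y) (hf : Measurable f)
    (hγ : 0 < γ) (hδ : 0 ≤ δ) {A G : ℝ}
    (hA : A = κ * (1 + 2 * γ + 2 * δ) ^ 2 / 2 + γ ^ 2 / 2 * κ)
    (hG : ∑' k : ℕ, ENNReal.ofReal (Real.exp (-(δ ^ 2 / 2 * Real.log 2 * k))) ≤ ENNReal.ofReal G)
    (hb : Real.exp (A - δ * b) * G ≤ Real.exp (-A) / 2) {s : ℝ} (hs : |s| ≤ 1)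
    {y : EuclideanSpace ℝ (Fin d)} (hy : y ∈ Metric.closedBall x ((2 : ℝ) ^ n)⁻¹)
    (hfy : 0 ≤ f y) :
    ENNReal.ofReal (f y * (Real.exp (d * n * Real.log 2) * (Real.exp (-A) / 2))) ≤
      ∫⁻ ω, tilt X x n s ω * thinDensity γ δ b X Km f x n K (y, ω) ∂P := by
  have hκ0 : 0 ≤ κ := (abs_nonneg _).trans (hκ.abs_diag_le 0 y)
  set N := X ((2 : ℝ) ^ n)⁻¹ x with hN
  set t : ℕ → ℝ := fun k => -(δ * ((γ + δ) * k * Real.log 2 + b)) with ht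
  set bad : ℕ → Ω → ℝ≥0∞ := fun k ω => tilt X x n s ω *
    ENNReal.ofReal (Real.exp (rescaledExp γ X Km x n (n + K) y ω) *
      Real.exp (δ * (X ((2 : ℝ) ^ (n + k))⁻¹ y ω - N ω) + t k)) with hbad
  have hmt : Measurable (tilt X x n s) := measurable_tilt hX s
  have hmr : Measurable fun ω => rescaledExp γ X Km x n (n + K) y ω :=
    (measurable_rescaledExp hX hdiag _).comp (measurable_const.prodMk measurable_id)
  have hmb : ∀ k, Measurable (bad k) := fun k => hmt.mul (hmr.exp.mul
    ((((hX.measurable_apply _ y).sub (hX.measurable_apply _ x)).const_mul _).add_const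
      _).exp).ennreal_ofReal
  have hmthin : Measurable fun ω => thinDensity γ δ b X Km f x n K (y, ω) :=
    (measurable_thinDensity hX hdiag hf).comp (measurable_const.prodMk measurable_id)
  have hpt : ∀ ω, tilt X x n s ω *
      ENNReal.ofReal (Real.exp (rescaledExp γ X Km x n (n + K) y ω) * f y) ≤
      tilt X x n s ω * thinDensity γ δ b X Km f x n K (y, ω) +
        ENNReal.ofReal (f y) * ∑ k ∈ Finset.range (K + 1), bad k ω := by
    intro ω
    by_cases hthin : (y, ω) ∈ thinPoints γ δ b X x n K
    · rw [thinDensity, Set.indicator_of_mem hthin]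
      exact le_self_add
    · refine le_trans ?_ le_add_self
      simp only [thinPoints, Set.mem_ofPred_eq, not_forall, not_le] at hthin
      obtain ⟨k, hk, hlt⟩ := hthin
      rw [ENNReal.ofReal_mul (Real.exp_pos _).le, ← mul_assoc, mul_comm]
      refine mul_le_mul_right (le_trans ?_ (Finset.single_le_sum (f := fun k => bad k ω)
        (fun _ _ => zero_le) hk)) _
      refine mul_le_mul_right (ENNReal.ofReal_le_ofReal ?_) _
      refine le_mul_of_one_le_right (Real.exp_pos _).le (Real.one_le_exp ?_)
      have := mul_le_mul_of_nonneg_left hlt.le hδ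
      simp only [ht]
      linarith
  have hfull : ENNReal.ofReal (f y * (Real.exp (d * n * Real.log 2) * Real.exp (-A))) ≤
      ∫⁻ ω, tilt X x n s ω *
        ENNReal.ofReal (Real.exp (rescaledExp γ X Km x n (n + K) y ω) * f y) ∂P := by
    obtain ⟨q, hq, hE⟩ := lintegral_tilt_rescaledExp hX hκ hγ le_rfl hs (Nat.zero_le K) hy 0
    have hqA : -A ≤ q := by
      have h1 : κ * (1 + 2 * γ + 2 * 0) ^ 2 ≤ κ * (1 + 2 * γ + 2 * δ) ^ 2 := by gcongr
      have := (abs_le.1 hq).1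
      linarith
    simp only [zero_mul, zero_add, Real.exp_zero, mul_one] at hE
    rw [mul_comm (f y), ← Real.exp_add]
    simp only [ENNReal.ofReal_mul (Real.exp_pos _).le, ← mul_assoc]
    rw [lintegral_mul_const' _ _ ENNReal.ofReal_ne_top, hE]
    refine mul_le_mul_left (ENNReal.ofReal_le_ofReal (Real.exp_le_exp.2 ?_)) _
    simp
    linarith
  have hbadle : ∀ k ∈ Finset.range (K + 1), ∫⁻ ω, bad k ω ∂P ≤
      ENNReal.ofReal (Real.exp (d * n * Real.log 2) * Real.exp (A - δ * b)) *
        ENNReal.ofReal (Real.exp (-(δ ^ 2 / 2 * Real.log 2 * k))) := by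
    intro k hk
    obtain ⟨q, hq, hE⟩ := lintegral_tilt_rescaledExp hX hκ hγ hδ hs
      (Nat.lt_succ_iff.1 (Finset.mem_range.1 hk)) hy (t k)
    rw [← hN] at hE
    rw [hbad, hE, ← Real.exp_add, ← ENNReal.ofReal_mul (Real.exp_pos _).le, ← Real.exp_add]
    refine ENNReal.ofReal_le_ofReal (Real.exp_le_exp.2 ?_)
    have := (abs_le.1 hq).2
    simp only [ht]
    linarith
  have hsum : ∫⁻ ω, ENNReal.ofReal (f y) * ∑ k ∈ Finset.range (K + 1), bad k ω ∂P ≤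
      ENNReal.ofReal (f y * (Real.exp (d * n * Real.log 2) * (Real.exp (-A) / 2))) := by
    rw [lintegral_const_mul' _ _ ENNReal.ofReal_ne_top, ENNReal.ofReal_mul hfy,
      lintegral_finsetSum _ fun k _ => hmb k]
    refine mul_le_mul_right ((Finset.sum_le_sum hbadle).trans ?_) _
    rw [← Finset.mul_sum]
    refine (mul_le_mul_right ((ENNReal.sum_le_tsum _).trans hG) _).trans ?_
    rw [← ENNReal.ofReal_mul (by positivity), mul_assoc]
    exact ENNReal.ofReal_le_ofReal (mul_le_mul_of_nonneg_left hb (Real.exp_pos _).le)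
  have hall := hfull.trans (lintegral_mono hpt)
  rw [lintegral_add_left (f := fun ω => tilt X x n s ω * thinDensity γ δ b X Km f x n K (y, ω))
    (hmt.mul hmthin)] at hall
  refine ENNReal.le_of_add_le_add_right (ENNReal.ofReal_ne_top
    (r := f y * (Real.exp (d * n * Real.log 2) * (Real.exp (-A) / 2)))) ?_
  refine le_trans (le_of_eq ?_) (hall.trans (add_le_add le_rfl hsum))
  rw [← ENNReal.ofReal_add (by positivity) (by positivity)]
  ring_nf

lemma lintegral_tilt_thinMass (hX : IsGaussianFamily P X Km)
    (hdiag : ∀ ε, 0 < ε → Measurable fun y => Km ε ε y y) (hf : Measurable f) (s : ℝ) :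
    ∫⁻ ω, tilt X x n s ω * thinMass γ δ b X Km f x n K ω ∂P =
      ∫⁻ y in Metric.closedBall x ((2 : ℝ) ^ n)⁻¹,
        ∫⁻ ω, tilt X x n s ω * thinDensity γ δ b X Km f x n K (y, ω) ∂P := by
  have hm := measurable_thinDensity (γ := γ) (δ := δ) (b := b) (x := x) (n := n) (K := K)
    hX hdiag hf
  have hmt : Measurable (tilt X x n s) := measurable_tilt hX s
  rw [← lintegral_lintegral_swap
    (f := fun ω y => tilt X x n s ω * thinDensity γ δ b X Km f x n K (y, ω))]
  · refine lintegral_congr fun ω => ?_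
    rw [lintegral_const_mul]
    · rfl
    · exact hm.comp (measurable_id.prodMk measurable_const)
  · exact ((hmt.comp measurable_fst).mul (hm.comp measurable_swap)).aemeasurable

lemma le_lintegral_tilt_thinMass (hX : IsGaussianFamily P X Km) (hκ : IsLogCovariance Km κ)
    (hdiag : ∀ ε, 0 < ε → Measurable fun y => Km ε ε y y) (hf : Measurable f)
    (hγ : 0 < γ) (hδ : 0 ≤ δ) {A G : ℝ}
    (hA : A = κ * (1 + 2 * γ + 2 * δ) ^ 2 / 2 + γ ^ 2 / 2 * κ)
    (hG : ∑' k : ℕ, ENNReal.ofReal (Real.exp (-(δ ^ 2 / 2 * Real.log 2 * k))) ≤ ENNReal.ofReal G)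
    (hb : Real.exp (A - δ * b) * G ≤ Real.exp (-A) / 2) {s : ℝ} (hs : |s| ≤ 1) {c : ℝ}
    (hc : 0 < c) (hfc : ∀ y ∈ Metric.closedBall x ((2 : ℝ) ^ n)⁻¹, c ≤ f y) :
    ENNReal.ofReal (c * (Real.exp (-A) / 2)) *
        volume (Metric.ball (0 : EuclideanSpace ℝ (Fin d)) 1) ≤
      ∫⁻ ω, tilt X x n s ω * thinMass γ δ b X Km f x n K ω ∂P := by
  rw [lintegral_tilt_thinMass hX hdiag hf]
  have h : ∀ y ∈ Metric.closedBall x ((2 : ℝ) ^ n)⁻¹,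
      ENNReal.ofReal (c * (Real.exp (d * n * Real.log 2) * (Real.exp (-A) / 2))) ≤
      ∫⁻ ω, tilt X x n s ω * thinDensity γ δ b X Km f x n K (y, ω) ∂P := fun y hy =>
    (ENNReal.ofReal_le_ofReal (mul_le_mul_of_nonneg_right (hfc y hy) (by positivity))).trans
      (le_lintegral_tilt_thinDensity hX hκ hdiag hf hγ hδ hA hG hb hs hy
        (hc.le.trans (hfc y hy)))
  refine le_trans (le_of_eq ?_) (setLIntegral_mono' Metric.isClosed_closedBall.measurableSet h)
  rw [setLIntegral_const, volume_closedBall_inv_two_pow, ← mul_assoc,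
    ← ENNReal.ofReal_mul (by positivity)]
  congr 2
  have : Real.exp (d * n * Real.log 2) * Real.exp (-(d * n * Real.log 2)) = 1 := by
    rw [← Real.exp_add, add_neg_cancel, Real.exp_zero]
  linear_combination (-(c * (Real.exp (-A) / 2))) * this

/-- The second moment of the tilted mass of thin points, as a double integral. -/
lemma lintegral_tilt_thinMass_sq (hX : IsGaussianFamily P X Km)
    (hdiag : ∀ ε, 0 < ε → Measurable fun y => Km ε ε y y) (hf : Measurable f) (s : ℝ) :
    ∫⁻ ω, (tilt X x n s ω * thinMass γ δ b X Km f x n K ω) ^ 2 ∂P =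
      ∫⁻ y in Metric.closedBall x ((2 : ℝ) ^ n)⁻¹, ∫⁻ z in Metric.closedBall x ((2 : ℝ) ^ n)⁻¹,
        (∫⁻ ω, tilt X x n s ω ^ 2 * (thinDensity γ δ b X Km f x n K (y, ω) *
          thinDensity γ δ b X Km f x n K (z, ω)) ∂P) := by
  set B := Metric.closedBall x ((2 : ℝ) ^ n)⁻¹
  set ρ := thinDensity γ δ b X Km f x n K
  have hm : Measurable ρ := measurable_thinDensity hX hdiag hf
  have hmt : Measurable (tilt X x n s) := measurable_tilt hX s
  have hmω : ∀ ω, Measurable fun y => ρ (y, ω) := fun ω =>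
    hm.comp (measurable_id.prodMk measurable_const)
  have h1 : ∀ ω, (tilt X x n s ω * thinMass γ δ b X Km f x n K ω) ^ 2 =
      ∫⁻ y in B, (∫⁻ z in B, tilt X x n s ω ^ 2 * (ρ (y, ω) * ρ (z, ω))) := by
    intro ω
    simp only [← mul_assoc]
    simp_rw [lintegral_const_mul _ (hmω ω)]
    rw [lintegral_mul_const _ ((hmω ω).const_mul _), lintegral_const_mul _ (hmω ω)]
    change (tilt X x n s ω * ∫⁻ y in B, ρ (y, ω)) ^ 2 = _
    ring
  simp only [h1]
  have hjoint : Measurable fun p : (Ω × EuclideanSpace ℝ (Fin d)) × EuclideanSpace ℝ (Fin d) =>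
      tilt X x n s p.1.1 ^ 2 * (ρ (p.1.2, p.1.1) * ρ (p.2, p.1.1)) :=
    ((hmt.comp (measurable_fst.comp measurable_fst)).pow_const 2).mul
      ((hm.comp ((measurable_snd.comp measurable_fst).prodMk
        (measurable_fst.comp measurable_fst))).mul
      (hm.comp (measurable_snd.prodMk (measurable_fst.comp measurable_fst))))
  rw [lintegral_lintegral_swap
    (f := fun ω y => ∫⁻ z in B, tilt X x n s ω ^ 2 * (ρ (y, ω) * ρ (z, ω)))
    (Measurable.lintegral_prod_right' hjoint).aemeasurable]
  refine lintegral_congr fun y => ?_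
  exact lintegral_lintegral_swap (f := fun ω z => tilt X x n s ω ^ 2 * (ρ (y, ω) * ρ (z, ω)))
    (hjoint.comp ((measurable_fst.prodMk measurable_const).prodMk measurable_snd)).aemeasurable

end Moments

lemma exists_isPairScale {n K : ℕ} {y z : EuclideanSpace ℝ (Fin d)}
    (h : dist y z ≤ 2 * ((2 : ℝ) ^ n)⁻¹) :
    ∃ k ≤ K, IsPairScale ((2 : ℝ) ^ (n + K))⁻¹ ((2 : ℝ) ^ (n + K))⁻¹ y z (n + k) := by
  have hε : ((2 : ℝ) ^ (n + K))⁻¹ ≤ 2 * ((2 : ℝ) ^ n)⁻¹ := by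
    have h1 : ((2 : ℝ) ^ (n + K))⁻¹ ≤ ((2 : ℝ) ^ n)⁻¹ :=
      inv_anti₀ (by positivity) (pow_le_pow_right₀ one_le_two (Nat.le_add_right n K))
    have h2 : (0 : ℝ) < ((2 : ℝ) ^ n)⁻¹ := by positivity
    linarith
  simp only [IsPairScale, max_self]
  set m := max (dist y z) ((2 : ℝ) ^ (n + K))⁻¹ with hm
  have hm0 : 0 < m := lt_max_of_lt_right (by positivity)
  have hm1 : m ≤ 2 * ((2 : ℝ) ^ n)⁻¹ := max_le h hε
  have hpow : (0 : ℝ) < 2 ^ n := by positivity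
  obtain ⟨k, hk1, hk2⟩ := exists_nat_pow_near_of_lt_one (x := m / 2 * 2 ^ n) (y := (2 : ℝ)⁻¹)
    (by positivity) (by
      rw [← le_div_iff₀ hpow, one_div]; linarith) (by norm_num) (by norm_num)
  have hk1' : ((2 : ℝ) ^ (n + k))⁻¹ ≤ m := by
    rw [pow_add, mul_inv]
    rw [inv_pow, pow_succ, mul_inv] at hk1
    have : ((2 : ℝ) ^ k)⁻¹ < m * 2 ^ n := by linarith
    rw [mul_comm, ← div_eq_mul_inv, div_le_iff₀ hpow]
    exact this.le
  have hk2' : m ≤ 2 * ((2 : ℝ) ^ (n + k))⁻¹ := by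
    rw [inv_pow, ← le_div_iff₀ hpow] at hk2
    rw [pow_add, mul_inv]
    rw [div_eq_mul_inv _ ((2 : ℝ) ^ n)] at hk2
    linarith
  rcases le_or_gt k K with hkK | hkK
  · exact ⟨k, hkK, hk1', hk2'⟩
  · refine ⟨K, le_rfl, le_max_right _ _, hk2'.trans ?_⟩
    have : ((2 : ℝ) ^ (n + k))⁻¹ ≤ ((2 : ℝ) ^ (n + K))⁻¹ :=
      inv_anti₀ (by positivity) (pow_le_pow_right₀ one_le_two (by omega))
    linarith

lemma volume_closedBall_two_mul (y : EuclideanSpace ℝ (Fin d)) (m : ℕ) :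
    volume (Metric.closedBall y (2 * ((2 : ℝ) ^ m)⁻¹)) =
      ENNReal.ofReal (2 ^ d * Real.exp (-(d * m * Real.log 2))) *
        volume (Metric.ball (0 : EuclideanSpace ℝ (Fin d)) 1) := by
  have h := volume_closedBall_inv_two_pow y m
  rw [Measure.addHaar_closedBall _ _ (by positivity), finrank_euclideanSpace, Fintype.card_fin]
    at h ⊢
  rw [mul_pow, ENNReal.ofReal_mul (by positivity), mul_assoc, h,
    ← mul_assoc, ← ENNReal.ofReal_mul (by positivity)]

/-- A second moment bound for the probability of an event carrying part of the first moment. -/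
lemma ofReal_le_measure_of_lintegral_sq_le {Ω : Type*} [MeasurableSpace Ω] {P : Measure Ω}
    {Y : Ω → ℝ≥0∞} {H : Set Ω} {m S : ℝ} (hm : 0 < m)
    (hS : 0 < S) (h1 : ENNReal.ofReal m ≤ ∫⁻ ω in H, Y ω ∂P)
    (h2 : ∫⁻ ω, Y ω ^ 2 ∂P ≤ ENNReal.ofReal S) :
    ENNReal.ofReal (m ^ 2 / (4 * S)) ≤ P H := by
  set t := 2 * S / m with ht
  have ht0 : 0 < t := by positivity
  have hpt : ∀ ω, Y ω ≤ ENNReal.ofReal t + ENNReal.ofReal t⁻¹ * Y ω ^ 2 := by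
    intro ω
    rcases le_total (Y ω) (ENNReal.ofReal t) with h | h
    · exact h.trans le_self_add
    · refine le_trans ?_ le_add_self
      calc Y ω = ENNReal.ofReal t⁻¹ * ENNReal.ofReal t * Y ω := by
            rw [← ENNReal.ofReal_mul (by positivity), inv_mul_cancel₀ ht0.ne', ENNReal.ofReal_one,
              one_mul]
        _ ≤ ENNReal.ofReal t⁻¹ * Y ω * Y ω := by gcongr
        _ = _ := by ring
  have h3 : ENNReal.ofReal m ≤ ENNReal.ofReal t * P H + ENNReal.ofReal (m / 2) := by
    calc ENNReal.ofReal m ≤ ∫⁻ ω in H, (ENNReal.ofReal t + ENNReal.ofReal t⁻¹ * Y ω ^ 2) ∂P :=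
          h1.trans (lintegral_mono fun ω => hpt ω)
      _ = ENNReal.ofReal t * P H + ENNReal.ofReal t⁻¹ * ∫⁻ ω in H, Y ω ^ 2 ∂P := by
          rw [lintegral_add_left measurable_const, setLIntegral_const,
            lintegral_const_mul' _ _ ENNReal.ofReal_ne_top]
      _ ≤ ENNReal.ofReal t * P H + ENNReal.ofReal t⁻¹ * ENNReal.ofReal S := by
          gcongr
          exact (setLIntegral_le_lintegral _ _).trans h2
      _ = _ := by
          rw [← ENNReal.ofReal_mul (by positivity)]
          congr 2
          rw [ht]; field_simp
  have h4 : ENNReal.ofReal (m / 2) ≤ ENNReal.ofReal t * P H := by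
    refine ENNReal.le_of_add_le_add_right (ENNReal.ofReal_ne_top (r := m / 2)) ?_
    rwa [← ENNReal.ofReal_add (by positivity) (by positivity), add_halves]
  have h5 : m ^ 2 / (4 * S) = t⁻¹ * (m / 2) := by rw [ht]; field_simp; norm_num
  rw [h5, ENNReal.ofReal_mul (by positivity)]
  refine (mul_le_mul_right h4 _).trans_eq ?_
  rw [← mul_assoc, ← ENNReal.ofReal_mul (by positivity), inv_mul_cancel₀ ht0.ne',
    ENNReal.ofReal_one, one_mul]

section SecondMoment

variable {Ω : Type*} [MeasurableSpace Ω] {P : Measure Ω} [IsProbabilityMeasure P]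
  {X : ℝ → EuclideanSpace ℝ (Fin d) → Ω → ℝ}
  {Km : ℝ → ℝ → EuclideanSpace ℝ (Fin d) → EuclideanSpace ℝ (Fin d) → ℝ}
  {γ δ b κ : ℝ} {f : EuclideanSpace ℝ (Fin d) → ℝ} {x : EuclideanSpace ℝ (Fin d)} {n K : ℕ}

lemma lintegral_tilt_thinMass_sq_le (hX : IsGaussianFamily P X Km) (hκ : IsLogCovariance Km κ)
    (hdiag : ∀ ε, 0 < ε → Measurable fun y => Km ε ε y y) (hf : Measurable f)
    (hγ : 0 < γ) {C : ℝ} {s : ℝ} (hs : |s| ≤ 1)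
    (hfC : ∀ y ∈ Metric.closedBall x ((2 : ℝ) ^ n)⁻¹, 0 ≤ f y ∧ f y ≤ C) :
    ∫⁻ ω, (tilt X x n s ω * thinMass γ δ b X Km f x n K ω) ^ 2 ∂P ≤
      ENNReal.ofReal (C ^ 2 * 2 ^ d * Real.exp (s ^ 2 * n * Real.log 2 + γ * b +
        κ * (2 + 4 * γ) ^ 2 / 2 + γ ^ 2 * κ)) *
        volume (Metric.ball (0 : EuclideanSpace ℝ (Fin d)) 1) ^ 2 *
        ∑' k : ℕ, ENNReal.ofReal (Real.exp (-((d - γ ^ 2 / 2 - γ * δ) * Real.log 2 * k))) := by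
  set B := Metric.closedBall x ((2 : ℝ) ^ n)⁻¹ with hB
  have hBm : MeasurableSet B := Metric.isClosed_closedBall.measurableSet
  set V := volume (Metric.ball (0 : EuclideanSpace ℝ (Fin d)) 1) with hV
  set F : ℕ → ℝ≥0∞ := fun k => ENNReal.ofReal (C ^ 2 * Real.exp (s ^ 2 * n * Real.log 2 +
    2 * d * n * Real.log 2 + (γ ^ 2 / 2 + γ * δ) * k * Real.log 2 + γ * b +
    κ * (2 + 4 * γ) ^ 2 / 2 + γ ^ 2 * κ)) with hF
  rw [lintegral_tilt_thinMass_sq hX hdiag hf]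
  have hbm : ∀ (y : EuclideanSpace ℝ (Fin d)) (k : ℕ),
      MeasurableSet (Metric.closedBall y (2 * ((2 : ℝ) ^ (n + k))⁻¹)) := fun y k =>
    Metric.isClosed_closedBall.measurableSet
  have hpt : ∀ y ∈ B, ∀ z ∈ B, ∫⁻ ω, tilt X x n s ω ^ 2 *
      (thinDensity γ δ b X Km f x n K (y, ω) * thinDensity γ δ b X Km f x n K (z, ω)) ∂P ≤
      ∑ k ∈ Finset.range (K + 1), F k *
        (Metric.closedBall y (2 * ((2 : ℝ) ^ (n + k))⁻¹)).indicator 1 z := by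
    intro y hy z hz
    have hyz : dist y z ≤ 2 * ((2 : ℝ) ^ n)⁻¹ := by
      have h1 : dist y x ≤ ((2 : ℝ) ^ n)⁻¹ := hy
      have h2 : dist z x ≤ ((2 : ℝ) ^ n)⁻¹ := hz
      linarith [dist_triangle_right y z x]
    obtain ⟨k, hk, hsc⟩ := exists_isPairScale (K := K) hyz
    refine (lintegral_tilt_sq_thinDensity_le hX hκ hγ hs hk hy hz hsc (hfC y hy)
      (hfC z hz)).trans ?_
    refine le_trans ?_ (Finset.single_le_sum (fun _ _ => zero_le)
      (Finset.mem_range.2 (Nat.lt_succ_of_le hk)))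
    rw [Set.indicator_of_mem, Pi.one_apply, mul_one]
    rw [Metric.mem_closedBall, dist_comm]
    exact (le_max_left _ _).trans hsc.2
  have hz : ∀ y ∈ B, ∫⁻ z in B, (∫⁻ ω, tilt X x n s ω ^ 2 *
      (thinDensity γ δ b X Km f x n K (y, ω) * thinDensity γ δ b X Km f x n K (z, ω)) ∂P) ≤
      ∑ k ∈ Finset.range (K + 1), F k *
        (ENNReal.ofReal (2 ^ d * Real.exp (-(d * (n + k : ℕ) * Real.log 2))) * V) := by
    intro y hy
    refine (setLIntegral_mono' hBm (hpt y hy)).trans ((setLIntegral_le_lintegral _ _).trans ?_)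
    rw [lintegral_finsetSum _ fun k _ => (measurable_one.indicator (hbm y k)).const_mul _]
    refine (Finset.sum_congr rfl fun k _ => ?_).le
    rw [lintegral_const_mul' _ _ ENNReal.ofReal_ne_top, lintegral_indicator_one (hbm y k),
      volume_closedBall_two_mul]
  refine (setLIntegral_mono' hBm hz).trans ?_
  rw [setLIntegral_const, volume_closedBall_inv_two_pow, Finset.sum_mul, ← ENNReal.tsum_mul_left]
  refine le_trans (Finset.sum_le_sum fun k _ => ?_) (ENNReal.sum_le_tsum (Finset.range (K + 1)))
  rw [hF]
  have e1 : C ^ 2 * Real.exp (s ^ 2 * n * Real.log 2 +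
      2 * d * n * Real.log 2 + (γ ^ 2 / 2 + γ * δ) * k * Real.log 2 + γ * b +
      κ * (2 + 4 * γ) ^ 2 / 2 + γ ^ 2 * κ) *
      (2 ^ d * Real.exp (-(d * (n + k : ℕ) * Real.log 2))) *
      Real.exp (-(d * n * Real.log 2)) = C ^ 2 * 2 ^ d * Real.exp (s ^ 2 * n * Real.log 2 + γ * b +
        κ * (2 + 4 * γ) ^ 2 / 2 + γ ^ 2 * κ) *
        Real.exp (-((d - γ ^ 2 / 2 - γ * δ) * Real.log 2 * k)) := by
    have : s ^ 2 * n * Real.log 2 +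
      2 * d * n * Real.log 2 + (γ ^ 2 / 2 + γ * δ) * k * Real.log 2 + γ * b +
      κ * (2 + 4 * γ) ^ 2 / 2 + γ ^ 2 * κ = (s ^ 2 * n * Real.log 2 + γ * b +
        κ * (2 + 4 * γ) ^ 2 / 2 + γ ^ 2 * κ) + (-((d - γ ^ 2 / 2 - γ * δ) * Real.log 2 * k)) -
        (-(d * (n + k : ℕ) * Real.log 2)) - (-(d * n * Real.log 2)) := by
      push_cast; ring
    rw [this, Real.exp_sub, Real.exp_sub, Real.exp_add]
    field_simp
  have e2 := congrArg ENNReal.ofReal e1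
  rw [ENNReal.ofReal_mul (by positivity), ENNReal.ofReal_mul (by positivity),
    ENNReal.ofReal_mul (q := Real.exp (-((d - γ ^ 2 / 2 - γ * δ) * Real.log 2 * k)))
      (by positivity)] at e2
  refine le_of_eq ?_
  dsimp only
  rw [mul_right_comm _ (V ^ 2), ← e2]
  ring

lemma lintegral_tilt_le (hX : IsGaussianFamily P X Km) (hκ : IsLogCovariance Km κ) {s : ℝ}
    (hs : |s| ≤ 1) : ∫⁻ ω, tilt X x n s ω ∂P ≤ ENNReal.ofReal (Real.exp (κ / 2)) := by
  have hκ0 : 0 ≤ κ := (abs_nonneg _).trans (hκ.abs_diag_le 0 x)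
  obtain ⟨q, hq, hE⟩ := hX.lintegral_exp_three hκ (k := 0) (J := n) (n := n) (x := x)
    (y := x) (by simp) (by simp) s 0 0 (-(s ^ 2 * n * Real.log 2 / 2))
  have heq : ∀ ω, tilt X x n s ω = ENNReal.ofReal (Real.exp (s * X ((2 : ℝ) ^ n)⁻¹ x ω +
      0 * X ((2 : ℝ) ^ n)⁻¹ x ω + 0 * X ((2 : ℝ) ^ (n + 0))⁻¹ x ω +
      -(s ^ 2 * n * Real.log 2 / 2))) := by
    intro ω; rw [tilt]; ring_nf
  simp only [heq]
  rw [hE]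
  refine ENNReal.ofReal_le_ofReal (Real.exp_le_exp.2 ?_)
  rw [abs_zero, add_zero, add_zero, sq_abs] at hq
  have h1 : κ * s ^ 2 ≤ κ * 1 := mul_le_mul_of_nonneg_left ((sq_le_one_iff_abs_le_one s).2 hs) hκ0
  have := (abs_le.1 hq).2
  linarith

lemma lintegral_rescaled_gmcMass_le (hX : IsGaussianFamily P X Km)
    (hκ : IsLogCovariance Km κ) (hdiag : ∀ ε, 0 < ε → Measurable fun y => Km ε ε y y)
    (hf : Measurable f) {C : ℝ} (hγ : 0 < γ)
    (hfA : ∀ y ∈ Metric.closedBall x ((2 : ℝ) ^ n)⁻¹, 0 ≤ f y ∧ f y ≤ C) :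
    ∫⁻ ω, ENNReal.ofReal (Real.exp ((d + γ ^ 2 / 2) * n * Real.log 2 -
        γ * X ((2 : ℝ) ^ n)⁻¹ x ω)) *
      gmcMass γ X Km f ((2 : ℝ) ^ (n + K))⁻¹ (Metric.closedBall x ((2 : ℝ) ^ n)⁻¹) ω ∂P ≤
    ENNReal.ofReal (C * Real.exp (5 / 2 * γ ^ 2 * κ)) *
        volume (Metric.ball (0 : EuclideanSpace ℝ (Fin d)) 1) := by
  have h := lintegral_exp_mul_gmcDensity_le hX hκ hdiag hf hγ (Nat.le_add_right n K) hfA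
  have heq : ∀ ω, ENNReal.ofReal (Real.exp ((d + γ ^ 2 / 2) * n * Real.log 2 -
        γ * X ((2 : ℝ) ^ n)⁻¹ x ω)) *
      gmcMass γ X Km f ((2 : ℝ) ^ (n + K))⁻¹ (Metric.closedBall x ((2 : ℝ) ^ n)⁻¹) ω =
      ENNReal.ofReal (Real.exp ((d + γ ^ 2 / 2) * n * Real.log 2)) *
      (ENNReal.ofReal (Real.exp (-γ * X ((2 : ℝ) ^ n)⁻¹ x ω)) *
      gmcMass γ X Km f ((2 : ℝ) ^ (n + K))⁻¹ (Metric.closedBall x ((2 : ℝ) ^ n)⁻¹) ω) := by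
    intro ω
    rw [← mul_assoc, ← ENNReal.ofReal_mul (Real.exp_pos _).le, ← Real.exp_add]
    ring_nf
  simp only [heq]
  rw [lintegral_const_mul' _ _ ENNReal.ofReal_ne_top]
  refine (mul_le_mul_right h _).trans_eq ?_
  rw [← mul_assoc, ← ENNReal.ofReal_mul (Real.exp_pos _).le, ← Real.exp_add, add_neg_cancel,
    Real.exp_zero, ENNReal.ofReal_one, one_mul]

end SecondMoment

section LowerHalf

variable {Ω : Type*} [MeasurableSpace Ω] {P : Measure Ω} [IsProbabilityMeasure P]
  {X : ℝ → EuclideanSpace ℝ (Fin d) → Ω → ℝ}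
  {Km : ℝ → ℝ → EuclideanSpace ℝ (Fin d) → EuclideanSpace ℝ (Fin d) → ℝ}
  {γ δ b κ : ℝ} {f : EuclideanSpace ℝ (Fin d) → ℝ} {x : EuclideanSpace ℝ (Fin d)} {n K : ℕ}

/-- If the tilted mass of thin points has first moment bounded below, then with probability
bounded below the field at `x` is at least `L` and the mass of thin points is of order one. -/
lemma ofReal_le_measure_thinMass (hX : IsGaussianFamily P X Km) (hκ : IsLogCovariance Km κ)
    (hdiag : ∀ ε, 0 < ε → Measurable fun y => Km ε ε y y) (hf : Measurable f)
    {m S M₁ η L s : ℝ} (hm : 0 < m) (hS : 0 < S) (hη : Real.exp (1 - η ^ 2 / 2) * M₁ ≤ m / 4)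
    (hs0 : 0 ≤ s) (hs1 : s ≤ 1) (hsL : s * L ≤ 1) (hsn : s ^ 2 * n * Real.log 2 = η ^ 2)
    (hfirst : ENNReal.ofReal m ≤ ∫⁻ ω, tilt X x n s ω * thinMass γ δ b X Km f x n K ω ∂P)
    (hthin : ∫⁻ ω, thinMass γ δ b X Km f x n K ω ∂P ≤ ENNReal.ofReal M₁)
    (hsecond : ∫⁻ ω, (tilt X x n s ω * thinMass γ δ b X Km f x n K ω) ^ 2 ∂P ≤ ENNReal.ofReal S) :
    ENNReal.ofReal ((m / 2) ^ 2 / (4 * S)) ≤ P {ω | L ≤ X ((2 : ℝ) ^ n)⁻¹ x ω ∧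
      ENNReal.ofReal (m / 4 / Real.exp (κ / 2)) ≤ thinMass γ δ b X Km f x n K ω} := by
  set N := X ((2 : ℝ) ^ n)⁻¹ x with hN
  set W := thinMass γ δ b X Km f x n K with hW
  set δ' := m / 4 / Real.exp (κ / 2) with hδ'
  have hNm : Measurable N := hX.measurable_apply _ _
  have hWm : Measurable W := measurable_thinMass hX hdiag hf
  have htm : Measurable (tilt X x n s) := measurable_tilt hX s
  set H := {ω | L ≤ N ω ∧ ENNReal.ofReal δ' ≤ W ω} with hH
  have hHm : MeasurableSet H :=
    (measurableSet_le measurable_const hNm).inter (measurableSet_le measurable_const hWm)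
  have hpt : ∀ ω ∈ Hᶜ, tilt X x n s ω * W ω ≤
      ENNReal.ofReal (Real.exp (1 - η ^ 2 / 2)) * W ω + tilt X x n s ω * ENNReal.ofReal δ' := by
    intro ω hω
    by_cases hL : L ≤ N ω
    · have hlt : W ω < ENNReal.ofReal δ' := by
        by_contra hcon
        exact hω ⟨hL, not_lt.1 hcon⟩
      exact (mul_le_mul_right hlt.le _).trans le_add_self
    · refine le_trans (mul_le_mul_left (ENNReal.ofReal_le_ofReal (Real.exp_le_exp.2 ?_)) _)
        le_self_add
      rw [hsn]
      have : s * N ω ≤ s * L := mul_le_mul_of_nonneg_left (not_le.1 hL).le hs0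
      linarith
  have hcompl : ∫⁻ ω in Hᶜ, tilt X x n s ω * W ω ∂P ≤ ENNReal.ofReal (m / 2) := by
    calc _ ≤ ∫⁻ ω, (ENNReal.ofReal (Real.exp (1 - η ^ 2 / 2)) * W ω +
          tilt X x n s ω * ENNReal.ofReal δ') ∂P :=
          (setLIntegral_mono' hHm.compl hpt).trans (setLIntegral_le_lintegral _ _)
      _ = ENNReal.ofReal (Real.exp (1 - η ^ 2 / 2)) * (∫⁻ ω, W ω ∂P) +
          (∫⁻ ω, tilt X x n s ω ∂P) * ENNReal.ofReal δ' := by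
          rw [lintegral_add_left (hWm.const_mul _), lintegral_const_mul' _ _ ENNReal.ofReal_ne_top,
            lintegral_mul_const' _ _ ENNReal.ofReal_ne_top]
      _ ≤ ENNReal.ofReal (Real.exp (1 - η ^ 2 / 2)) * ENNReal.ofReal M₁ +
          ENNReal.ofReal (Real.exp (κ / 2)) * ENNReal.ofReal δ' := by
          gcongr
          exact lintegral_tilt_le hX hκ (by rwa [abs_of_nonneg hs0])
      _ ≤ ENNReal.ofReal (m / 4) + ENNReal.ofReal (m / 4) := by
          rw [← ENNReal.ofReal_mul (Real.exp_pos _).le, ← ENNReal.ofReal_mul (Real.exp_pos _).le]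
          gcongr
          rw [hδ', mul_div_cancel₀ _ (Real.exp_pos _).ne']
      _ = ENNReal.ofReal (m / 2) := by
          rw [← ENNReal.ofReal_add (by positivity) (by positivity)]
          ring_nf
  refine ofReal_le_measure_of_lintegral_sq_le (by positivity) hS ?_ hsecond
  rw [← lintegral_add_compl _ hHm] at hfirst
  refine ENNReal.le_of_add_le_add_right (ENNReal.ofReal_ne_top (r := m / 2)) ?_
  refine le_trans (le_of_eq ?_) (hfirst.trans (add_le_add le_rfl hcompl))
  rw [← ENNReal.ofReal_add (by positivity) (by positivity), add_halves]

lemma exists_tsum_ofReal_exp_neg_eq {c : ℝ} (hc : 0 < c) : ∃ G : ℝ, 0 ≤ G ∧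
    ∑' n : ℕ, ENNReal.ofReal (Real.exp (-(c * n))) = ENNReal.ofReal G :=
  ⟨_, ENNReal.toReal_nonneg, (ENNReal.ofReal_toReal (tsum_ofReal_exp_neg_lt_top hc).ne).symm⟩

lemma exists_exp_one_sub_sq_mul_le {a b : ℝ} (ha : 0 < a) (hb : 0 < b) :
    ∃ η : ℝ, 0 < η ∧ Real.exp (1 - η ^ 2 / 2) * a ≤ b := by
  have hl0 := abs_nonneg (Real.log (b / a))
  refine ⟨|Real.log (b / a)| + 3, by linarith, ?_⟩
  rw [← le_div_iff₀ ha, ← Real.le_log_iff_exp_le (by positivity)]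
  have := neg_abs_le (Real.log (b / a))
  nlinarith

lemma exists_tilt_parameter {η L : ℝ} (hη : 0 < η) (hL : 0 ≤ L) :
    ∃ n : ℕ, 1 ≤ n ∧ ∃ s : ℝ, 0 < s ∧ s ≤ 1 ∧ s * L ≤ 1 ∧ s ^ 2 * n * Real.log 2 = η ^ 2 := by
  have hlog : 0 < Real.log 2 := Real.log_pos one_lt_two
  obtain ⟨n, hn⟩ := exists_nat_ge (η ^ 2 * (1 + L) ^ 2 / Real.log 2)
  have hn0 : (0 : ℝ) < n := lt_of_lt_of_le (by positivity) hn
  rw [div_le_iff₀ hlog] at hn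
  have hsq := Real.sq_sqrt (show 0 ≤ n * Real.log 2 by positivity)
  have hsq0 := Real.sqrt_pos.2 (show 0 < n * Real.log 2 by positivity)
  have hs0 : 0 < η / Real.sqrt (n * Real.log 2) := by positivity
  have hsL : η / Real.sqrt (n * Real.log 2) * (1 + L) ≤ 1 := by
    rw [div_mul_eq_mul_div, div_le_one hsq0]
    refine Real.le_sqrt_of_sq_le ?_
    rwa [mul_pow]
  refine ⟨n, by exact_mod_cast hn0, η / Real.sqrt (n * Real.log 2), hs0, by nlinarith,
    by nlinarith, ?_⟩
  rw [div_pow, hsq]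
  field_simp

/-- The chaos masses of small balls around `x`, rescaled at the critical rate, are not tight. -/
lemma exists_ofReal_le_measure_gmcMass (hX : IsGaussianFamily P X Km)
    (hκ : IsLogCovariance Km κ)
    (hdiag : ∀ ε, 0 < ε → Measurable fun y => Km ε ε y y) (hf : Measurable f) (hγ : 0 < γ)
    (hγ2 : γ ^ 2 < 2 * d) {c C : ℝ} (hc : 0 < c)
    (hfb : ∀ y ∈ Metric.closedBall x 1, c ≤ f y ∧ f y ≤ C) :
    ∃ p > 0, ∀ T : ℝ, ∃ n : ℕ, 1 ≤ n ∧ ∀ K : ℕ, ENNReal.ofReal p ≤ P {ω | ENNReal.ofReal T ≤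
      ENNReal.ofReal (Real.exp ((d + γ ^ 2 / 2) * n * Real.log 2)) *
        gmcMass γ X Km f ((2 : ℝ) ^ (n + K))⁻¹ (Metric.closedBall x ((2 : ℝ) ^ n)⁻¹) ω} := by
  have hlog : 0 < Real.log 2 := Real.log_pos one_lt_two
  have hfn : ∀ n : ℕ, ∀ y ∈ Metric.closedBall x ((2 : ℝ) ^ n)⁻¹, c ≤ f y ∧ f y ≤ C :=
    fun n y hy => hfb y (closedBall_inv_two_pow_subset x n hy)
  have hfn0 : ∀ n : ℕ, ∀ y ∈ Metric.closedBall x ((2 : ℝ) ^ n)⁻¹, 0 ≤ f y ∧ f y ≤ C :=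
    fun n y hy => ⟨hc.le.trans (hfn n y hy).1, (hfn n y hy).2⟩
  have hC : 0 < C := by
    have := hfb x (Metric.mem_closedBall_self zero_le_one)
    linarith
  obtain ⟨δ, hδ0, hδ⟩ : ∃ δ, 0 < δ ∧ 0 < d - γ ^ 2 / 2 - γ * δ := by
    refine ⟨(d - γ ^ 2 / 2) / (2 * γ), div_pos (by linarith) (by linarith), ?_⟩
    have : γ * ((d - γ ^ 2 / 2) / (2 * γ)) = (d - γ ^ 2 / 2) / 2 := by field_simp
    linarith
  obtain ⟨v, hv0, hv⟩ : ∃ v : ℝ, 0 < v ∧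
      volume (Metric.ball (0 : EuclideanSpace ℝ (Fin d)) 1) = ENNReal.ofReal v :=
    ⟨_, ENNReal.toReal_pos (Metric.measure_ball_pos _ _ one_pos).ne' measure_ball_lt_top.ne,
      (ENNReal.ofReal_toReal measure_ball_lt_top.ne).symm⟩
  set A := κ * (1 + 2 * γ + 2 * δ) ^ 2 / 2 + γ ^ 2 / 2 * κ with hA
  obtain ⟨G, hG0, hG⟩ := exists_tsum_ofReal_exp_neg_eq (c := δ ^ 2 / 2 * Real.log 2)
    (by positivity)
  obtain ⟨b, hb⟩ : ∃ b, Real.exp (A - δ * b) * G ≤ Real.exp (-A) / 2 := by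
    refine ⟨(2 * A + Real.log (2 * (G + 1))) / δ, ?_⟩
    have h1 : A - δ * ((2 * A + Real.log (2 * (G + 1))) / δ) =
        -A - Real.log (2 * (G + 1)) := by field_simp; ring
    rw [h1, Real.exp_sub, Real.exp_log (by positivity), div_mul_eq_mul_div,
      div_le_div_iff₀ (by positivity) two_pos]
    nlinarith [Real.exp_pos (-A)]
  set m := c * (Real.exp (-A) / 2) * v with hm
  have hm0 : 0 < m := by positivity
  set M₁ := C * Real.exp (5 / 2 * γ ^ 2 * κ) * v with hM₁
  have hM₁0 : 0 < M₁ := by positivity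
  obtain ⟨η, hη0, hη⟩ := exists_exp_one_sub_sq_mul_le hM₁0 (show 0 < m / 4 by positivity)
  obtain ⟨G₂, hG₂0, hG₂⟩ := exists_tsum_ofReal_exp_neg_eq
    (c := (d - γ ^ 2 / 2 - γ * δ) * Real.log 2) (by positivity)
  set S := C ^ 2 * 2 ^ d * Real.exp (η ^ 2 + γ * b + κ * (2 + 4 * γ) ^ 2 / 2 + γ ^ 2 * κ) *
    v ^ 2 * (G₂ + 1) with hS
  have hS0 : 0 < S := by positivity
  set δ' := m / 4 / Real.exp (κ / 2) with hδ'
  have hδ'0 : 0 < δ' := by positivity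
  refine ⟨(m / 2) ^ 2 / (4 * S), by positivity, fun T => ?_⟩
  set L := |T| / δ' / γ with hL
  have hL0 : 0 ≤ L := by positivity
  obtain ⟨n, hn, s, hs0, hs1, hsL, hsn⟩ := exists_tilt_parameter hη0 hL0
  refine ⟨n, hn, fun K => ?_⟩
  have hsabs : |s| ≤ 1 := by rwa [abs_of_pos hs0]
  clear_value L δ' S M₁ m A
  refine le_trans (ofReal_le_measure_thinMass (x := x) (γ := γ) (b := b) (δ := δ) (L := L) (n := n) (K := K)
    hX hκ hdiag hf hm0 hS0 hη hs0.le hs1 hsL hsn ?_ ?_ ?_) (measure_mono ?_)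
  · refine le_trans (le_of_eq ?_) (le_lintegral_tilt_thinMass hX hκ hdiag hf hγ hδ0.le hA hG.le hb
      hsabs hc fun y hy => (hfn n y hy).1)
    rw [hv, ← ENNReal.ofReal_mul (by positivity), hm]
  · refine (lintegral_mono fun ω => thinMass_le ω).trans
      ((lintegral_rescaled_gmcMass_le hX hκ hdiag hf hγ (hfn0 n)).trans_eq ?_)
    rw [hv, ← ENNReal.ofReal_mul (by positivity), hM₁]
  · refine (lintegral_tilt_thinMass_sq_le hX hκ hdiag hf hγ hsabs (hfn0 n)).trans ?_
    rw [hv, hG₂, hsn, ← ENNReal.ofReal_pow hv0.le, ← ENNReal.ofReal_mul (by positivity),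
      ← ENNReal.ofReal_mul (by positivity)]
    refine ENNReal.ofReal_le_ofReal ?_
    rw [hS]
    gcongr
    linarith
  · rintro ω ⟨h1, h2⟩
    rw [← hδ'] at h2
    have h3 := h2.trans (thinMass_le ω)
    have hT : T ≤ Real.exp (γ * X ((2 : ℝ) ^ n)⁻¹ x ω) * δ' := by
      have h4 : γ * L ≤ γ * X ((2 : ℝ) ^ n)⁻¹ x ω := mul_le_mul_of_nonneg_left h1 hγ.le
      have h5 : γ * L = |T| / δ' := by rw [hL]; field_simp
      have h6 := Real.add_one_le_exp (γ * X ((2 : ℝ) ^ n)⁻¹ x ω)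
      have h7 : |T| / δ' ≤ Real.exp (γ * X ((2 : ℝ) ^ n)⁻¹ x ω) := by linarith
      exact (le_abs_self T).trans ((div_le_iff₀ hδ'0).1 h7)
    refine (ENNReal.ofReal_le_ofReal hT).trans ?_
    rw [ENNReal.ofReal_mul (Real.exp_pos _).le]
    refine (mul_le_mul_right h3 _).trans_eq ?_
    rw [← mul_assoc, ← ENNReal.ofReal_mul (Real.exp_pos _).le, ← Real.exp_add]
    ring_nf

variable {D : Set (EuclideanSpace ℝ (Fin d))} {M : Ω → Measure (EuclideanSpace ℝ (Fin d))}

/-- A lower bound on the probability that the approximate masses are large passes to the limit. -/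
lemma IsGMCMeasure.ofReal_le_measure (hX : IsGaussianFamily P X Km)
    (hdiag : ∀ ε, 0 < ε → Measurable fun y => Km ε ε y y)
    (hM : IsGMCMeasure P γ X Km f D M)
    (hf : Measurable f) {C : ℝ} {A : Set (EuclideanSpace ℝ (Fin d))} (hA : IsCompact A)
    (hAD : A ⊆ D) (hfA : ∀ y ∈ A, 0 ≤ f y ∧ f y ≤ C) {a : ℝ} (ha : 0 < a) {n : ℕ} {p : ℝ≥0∞}
    (h : ∀ K : ℕ, p ≤ P {ω | ENNReal.ofReal a ≤ gmcMass γ X Km f ((2 : ℝ) ^ (n + K))⁻¹ A ω}) :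
    p ≤ P {ω | ENNReal.ofReal (a / 2) ≤ M ω A} := by
  have hAc : closure A = A := hA.isClosed.closure_eq
  have htend := hM.2.2 A hA.measurableSet (by rwa [hAc]) (by rwa [hAc]) (ENNReal.ofReal (a / 2))
    (ENNReal.ofReal_pos.2 (half_pos ha))
  have htend' := (htend.comp tendsto_inv_two_pow).comp (tendsto_add_atTop_nat n)
  refine ge_of_tendsto' (x := atTop) (f := fun K : ℕ => P {ω | ENNReal.ofReal (a / 2) ≤ M ω A} +
    P {ω | ENNReal.ofReal (a / 2) ≤ edist (approxGMC γ X Km f ((2 : ℝ) ^ (K + n))⁻¹ ω A)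
      (M ω A).toReal}) ?_ fun K => ?_
  · simpa using htend'.const_add (P {ω | ENNReal.ofReal (a / 2) ≤ M ω A})
  · refine (h K).trans (le_trans (measure_mono_ae ?_) (measure_union_le _ _))
    have hε : ((2 : ℝ) ^ (n + K))⁻¹ ∈ Set.Ioc (0 : ℝ) 1 :=
      ⟨by positivity, inv_le_one_of_one_le₀ (one_le_pow₀ one_le_two)⟩
    filter_upwards [ae_ofReal_approxGMC (γ := γ) hX hε (hdiag _ hε.1) hf hA.measurableSet
      hA.measure_ne_top hfA] with ω hω hle
    change ENNReal.ofReal a ≤ gmcMass γ X Km f ((2 : ℝ) ^ (n + K))⁻¹ A ω at hle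
    rw [← hω, ENNReal.ofReal_le_ofReal_iff' ] at hle
    have hle' : a ≤ approxGMC γ X Km f ((2 : ℝ) ^ (n + K))⁻¹ ω A := by
      rcases hle with h1 | h1
      · exact h1
      · exact absurd ha (not_lt.2 h1)
    by_cases hcase : ENNReal.ofReal (a / 2) ≤ M ω A
    · exact Or.inl hcase
    · refine Or.inr ?_
      have hMr : (M ω A).toReal ≤ a / 2 :=
        ENNReal.toReal_le_of_le_ofReal (half_pos ha).le (not_le.1 hcase).le
      change ENNReal.ofReal (a / 2) ≤ edist _ _
      rw [edist_dist, add_comm K n]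
      refine ENNReal.ofReal_le_ofReal ?_
      rw [Real.dist_eq]
      exact le_trans (by linarith) (le_abs_self _)

lemma exp_mul_measure_closedBall_le_lintegral {β : ℝ} (hβ : 0 ≤ β) {n : ℕ} (hn : 1 ≤ n)
    (μ : Measure (EuclideanSpace ℝ (Fin d))) :
    ENNReal.ofReal (Real.exp (β * n * Real.log 2)) * μ (Metric.closedBall x ((2 : ℝ) ^ n)⁻¹) ≤
      ∫⁻ y in Metric.ball x 1, ENNReal.ofReal (dist y x) ^ (-β) ∂μ := by
  have hsub : Metric.closedBall x ((2 : ℝ) ^ n)⁻¹ ⊆ Metric.ball x 1 :=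
    Metric.closedBall_subset_ball (inv_lt_one_of_one_lt₀ (one_lt_pow₀ one_lt_two (by omega)))
  rw [← setLIntegral_const]
  refine le_trans (setLIntegral_mono' Metric.isClosed_closedBall.measurableSet fun y hy => ?_)
    (lintegral_mono_set hsub)
  have h1 : ENNReal.ofReal (Real.exp (β * n * Real.log 2)) =
      ENNReal.ofReal (((2 : ℝ) ^ n)⁻¹) ^ (-β) := by
    rw [ENNReal.ofReal_rpow_of_pos (by positivity), Real.rpow_def_of_pos (by positivity),
      Real.log_inv, Real.log_pow]
    ring_nf
  rw [h1, ENNReal.rpow_neg, ENNReal.rpow_neg]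
  exact ENNReal.inv_le_inv.2 (ENNReal.rpow_le_rpow (ENNReal.ofReal_le_ofReal hy) hβ)

/-- A function which is at least `T` on an event of probability at least `p > 0`, for every `T`,
is infinite with positive probability. -/
lemma not_ae_lt_top_of_le_measure {I : Ω → ℝ≥0∞} {E : ℕ → Set Ω} (hE : ∀ T, MeasurableSet (E T))
    {p : ℝ≥0∞} (hp : 0 < p) (hpE : ∀ T, p ≤ P (E T)) (hEI : ∀ T, ∀ ω ∈ E T, (T : ℝ≥0∞) ≤ I ω) :
    ¬ ∀ᵐ ω ∂P, I ω < ⊤ := by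
  intro hfin
  have hanti : Antitone fun N : ℕ => ⋃ T ≥ N, E T := fun N N' h =>
    Set.biUnion_subset_biUnion_left fun T (hT : N' ≤ T) => h.trans hT
  have htend := tendsto_measure_iInter_atTop (μ := P) (s := fun N : ℕ => ⋃ T ≥ N, E T)
    (fun N => (MeasurableSet.biUnion (Set.to_countable _) fun T _ => hE T).nullMeasurableSet)
    hanti ⟨0, measure_ne_top _ _⟩
  have hge : p ≤ P (⋂ N : ℕ, ⋃ T ≥ N, E T) := ge_of_tendsto' htend fun N =>
    (hpE N).trans (measure_mono (Set.subset_biUnion_of_mem (u := E) (le_refl N)))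
  have hzero : P (⋂ N : ℕ, ⋃ T ≥ N, E T) = 0 := by
    refine measure_mono_null (t := {ω | ¬ I ω < ⊤}) (fun ω hω hlt => ?_) (ae_iff.1 hfin)
    obtain ⟨N, hN⟩ := ENNReal.exists_nat_gt (ne_of_lt hlt)
    obtain ⟨T, hT, hωT⟩ := Set.mem_iUnion₂.1 (Set.mem_iInter.1 hω N)
    exact absurd ((Nat.cast_le.2 hT).trans (hEI T ω hωT)) (not_le.2 hN)
  exact absurd (hge.trans_eq hzero) (not_le.2 hp)

lemma IsGMCMeasure.not_ae_lintegral_lt_top (hX : IsGaussianFamily P X Km)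
    (hκ : IsLogCovariance Km κ)
    (hdiag : ∀ ε, 0 < ε → Measurable fun y => Km ε ε y y)
    (hM : IsGMCMeasure P γ X Km f D M) (hf : Measurable f) (hγ : 0 < γ)
    (hγ2 : γ ^ 2 < 2 * d) {c C : ℝ} (hc : 0 < c) (hfD : ∀ y ∈ D, c ≤ f y ∧ f y ≤ C)
    (hD : Metric.closedBall x 1 ⊆ D) {β : ℝ} (hβ : d + γ ^ 2 / 2 ≤ β) :
    ¬ ∀ᵐ ω ∂P, ∫⁻ y in Metric.ball x 1, ENNReal.ofReal (dist y x) ^ (-β) ∂(M ω) < ⊤ := by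
  obtain ⟨p, hp, hpT⟩ := exists_ofReal_le_measure_gmcMass hX hκ hdiag hf hγ hγ2 hc
    fun y hy => hfD y (hD hy)
  have hβ0 : 0 ≤ β := le_trans (by positivity) hβ
  choose n hn hK using fun T : ℕ => hpT (2 * (T + 1))
  set R : ℕ → ℝ := fun T => Real.exp ((d + γ ^ 2 / 2) * n T * Real.log 2) with hR
  have hR0 : ∀ T, 0 < R T := fun T => Real.exp_pos _
  refine not_ae_lt_top_of_le_measure (p := ENNReal.ofReal p)
    (E := fun T => {ω | ENNReal.ofReal (2 * (T + 1) / R T / 2) ≤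
      M ω (Metric.closedBall x ((2 : ℝ) ^ n T)⁻¹)})
    (fun T => measurableSet_le measurable_const
      (hM.1 _ Metric.isClosed_closedBall.measurableSet))
    (ENNReal.ofReal_pos.2 hp) (fun T => ?_) fun T ω hω => ?_
  · have hBD : Metric.closedBall x ((2 : ℝ) ^ n T)⁻¹ ⊆ D :=
      (closedBall_inv_two_pow_subset x (n T)).trans hD
    have hRT := hR0 T
    refine hM.ofReal_le_measure hX hdiag hf (isCompact_closedBall _ _) hBD
      (C := C) (fun y hy => ⟨hc.le.trans (hfD y (hBD hy)).1, (hfD y (hBD hy)).2⟩)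
      (a := 2 * (T + 1) / R T) (by positivity) (n := n T) fun K =>
        (hK T K).trans (measure_mono fun ω hω => ?_)
    change ENNReal.ofReal (2 * (T + 1)) ≤ ENNReal.ofReal (R T) * _ at hω
    change ENNReal.ofReal (2 * (T + 1) / R T) ≤ _
    rw [ENNReal.ofReal_div_of_pos (hR0 T)]
    exact ENNReal.div_le_of_le_mul' hω
  · change ENNReal.ofReal (2 * (T + 1) / R T / 2) ≤ M ω _ at hω
    refine le_trans ?_ (exp_mul_measure_closedBall_le_lintegral hβ0 (hn T) (M ω))
    calc (T : ℝ≥0∞) = ENNReal.ofReal T := (ENNReal.ofReal_natCast T).symm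
      _ ≤ ENNReal.ofReal (R T * (2 * (T + 1) / R T / 2)) := by
          refine ENNReal.ofReal_le_ofReal ?_
          have := (hR0 T).ne'
          have : R T * (2 * (T + 1) / R T / 2) = T + 1 := by field_simp
          linarith
      _ = ENNReal.ofReal (R T) * ENNReal.ofReal (2 * (T + 1) / R T / 2) :=
          ENNReal.ofReal_mul (hR0 T).le
      _ ≤ _ := by
          have hRle : R T ≤ Real.exp (β * n T * Real.log 2) := by
            refine Real.exp_le_exp.2 ?_
            gcongr
          exact mul_le_mul' (ENNReal.ofReal_le_ofReal hRle) hω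

end LowerHalf

/-- **First Seiberg bound.** Let `γ ∈ (0, √(2d))`, `f` measurable with `0 < c ≤ f ≤ C` on `D`,
`M` the Gaussian multiplicative chaos measure on `D`, `x ∈ D` with the closed unit ball around
`x` contained in `D`, and `α ∈ ℝ`. Then `∫_{B(x,1)} |y-x|^{-αγ} M(dy) < ∞` almost surely if
and only if `α < d/γ + γ/2`. -/
theorem gmc_first_seiberg_bound (hd : 1 ≤ d)
    (g : EuclideanSpace ℝ (Fin d) → EuclideanSpace ℝ (Fin d) → ℝ) (hg : IsBoundedMeasurable g)
    (θ : EuclideanSpace ℝ (Fin d) → ℝ) (hθ : IsMollifier θ)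
    {Ω : Type*} [MeasurableSpace Ω] (P : Measure Ω) [IsProbabilityMeasure P]
    (X : ℝ → EuclideanSpace ℝ (Fin d) → Ω → ℝ)
    (hX : IsGaussianFamily P X (mollifiedCov (logKernel g) θ θ))
    (γ : ℝ) (hγ0 : 0 < γ) (hγ2 : γ < Real.sqrt (2 * d))
    (D : Set (EuclideanSpace ℝ (Fin d))) (hD : IsOpen D) (hDne : D.Nonempty)
    (f : EuclideanSpace ℝ (Fin d) → ℝ) (hfmeas : Measurable f)
    (hfbd : ∃ c C : ℝ, 0 < c ∧ ∀ x ∈ D, c ≤ f x ∧ f x ≤ C)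
    (M : Ω → Measure (EuclideanSpace ℝ (Fin d)))
    (hM : IsGMCMeasure P γ X (mollifiedCov (logKernel g) θ θ) f D M)
    (x : EuclideanSpace ℝ (Fin d)) (hx : x ∈ D) (hball : Metric.closedBall x 1 ⊆ D)
    (α : ℝ) :
    (∀ᵐ ω ∂P,
      (∫⁻ y in Metric.ball x 1, (ENNReal.ofReal (dist y x)) ^ (-(α * γ)) ∂(M ω)) < ⊤) ↔
    α < d / γ + γ / 2 := by
  obtain ⟨κ, -, hκ⟩ := hθ.exists_isLogCovariance hd hg
  obtain ⟨c, C, hc, hf⟩ := hfbd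
  have hdiag : ∀ ε, 0 < ε → Measurable fun y => mollifiedCov (logKernel g) θ θ ε ε y y :=
    fun ε hε => measurable_mollifiedCov_diag hg hθ hε
  have hγ : γ ^ 2 < 2 * d := (Real.lt_sqrt hγ0.le).1 hγ2
  have hiff : α < d / γ + γ / 2 ↔ α * γ < d + γ ^ 2 / 2 := by
    have : d + γ ^ 2 / 2 = (d / γ + γ / 2) * γ := by field_simp
    rw [this, mul_lt_mul_iff_of_pos_right hγ0]
  rw [hiff]
  refine ⟨fun hfin => ?_, fun hα => hM.ae_lintegral_lt_top hX hκ hdiag hfmeas hγ0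
    (fun y hy => ⟨hc.le.trans (hf y hy).1, (hf y hy).2⟩) hball hα⟩
  by_contra hα
  exact hM.not_ae_lintegral_lt_top hX hκ hdiag hfmeas hγ0 hγ hc hf hball (not_lt.1 hα) hfin

end
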